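/- arXiv:2605.31225 — 3 statements merged into one kernel-verified Lean document; each statement's English description precedes it below -/
import Mathlib

section
/- Let G be a cactus graph on n vertices and let ℓ ≥ 4 be an integer. Then any two proper ℓ-colorings of G are joined by a path of length at most 3·n in the ℓ-reconfiguration graph R_ℓ(G); in particular, R_ℓ(G) is connected and has diameter at most 3·n. -/
open SimpleGraph

/-- A proper coloring of `G` with `ℓ` colors: adjacent vertices get distinct colors. -/
def IsProperColoring {V : Type} (G : SimpleGraph V) {ℓ : ℕ} (c : V → Fin ℓ) : Prop :=
  ∀ ⦃u v : V⦄, G.Adj u v → c u ≠ c v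

/-- `c` is a transformation sequence from `α` to `β`: a sequence of proper colorings
starting at `α`, ending at `β`, in which consecutive colorings differ on exactly one vertex. -/
def IsTransformSeq {V : Type} (G : SimpleGraph V) {ℓ m : ℕ}
    (c : Fin (m + 1) → V → Fin ℓ) (α β : V → Fin ℓ) : Prop :=
  c 0 = α ∧ c (Fin.last m) = β ∧ (∀ i, IsProperColoring G (c i)) ∧
    ∀ i : Fin m, ∃! v : V, c i.castSucc v ≠ c i.succ v

/-- The number of steps of the sequence `c` at which the vertex `v` is recolored. -/
def RecolorCount {V : Type} {ℓ m : ℕ} (c : Fin (m + 1) → V → Fin ℓ) (v : V) : ℕ :=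
  (Finset.univ.filter fun i : Fin m => c i.castSucc v ≠ c i.succ v).card

/-- `H` is a minor of `G`: there are pairwise disjoint nonempty branch sets in `G`, each
inducing a connected subgraph, with an edge of `G` between the branch sets of any two
vertices adjacent in `H`. -/
def IsMinor {W V : Type} (H : SimpleGraph W) (G : SimpleGraph V) : Prop :=
  ∃ B : W → Set V,
    (∀ h, (B h).Nonempty) ∧
    (Pairwise fun h h' => Disjoint (B h) (B h')) ∧
    (∀ h, (G.induce (B h)).Connected) ∧
    ∀ ⦃h h'⦄, H.Adj h h' → ∃ u ∈ B h, ∃ v ∈ B h', G.Adj u v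

/-- Every edge of `G` lies on at most one cycle: two cycles sharing an edge have the
same edge set. -/
def EdgeOnAtMostOneCycle {V : Type} (G : SimpleGraph V) : Prop :=
  ∀ (u v : V) (p : G.Walk u u) (q : G.Walk v v), p.IsCycle → q.IsCycle →
    ∀ e, e ∈ p.edges → e ∈ q.edges → ∀ e', (e' ∈ p.edges ↔ e' ∈ q.edges)

/-- A cactus graph: connected and every edge lies on at most one cycle. -/
def IsCactus {V : Type} (G : SimpleGraph V) : Prop :=
  G.Connected ∧ EdgeOnAtMostOneCycle G

/-- A chordal graph: every cycle of length at least `4` has a chord; equivalently,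
there is no induced cycle of length at least `4`. -/
def IsChordal {V : Type} (G : SimpleGraph V) : Prop :=
  ∀ (v : V) (p : G.Walk v v), p.IsCycle → 4 ≤ p.length →
    ∃ u w, u ∈ p.support ∧ w ∈ p.support ∧ G.Adj u w ∧ s(u, w) ∉ p.edges

/-- The sequence of successive colors taken by the vertex `v` along the sequence `c`
(its starting color followed by the new color at each of its recolorings). -/
def ColorTrace {V : Type} {ℓ m : ℕ} (c : Fin (m + 1) → V → Fin ℓ) (v : V) : List (Fin ℓ) :=
  (List.ofFn fun i : Fin (m + 1) => c i v).destutter (· ≠ ·)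

/-- The coloring `t` can be reached from `s` by at most `m` single-vertex recolorings. -/
def ReachableWithin {V : Type} (G : SimpleGraph V) {ℓ : ℕ} (m : ℕ) (s t : V → Fin ℓ) : Prop :=
  ∃ k ≤ m, ∃ c : Fin (k + 1) → V → Fin ℓ, IsTransformSeq G c s t

theorem ReachableWithin.refl {V : Type} {G : SimpleGraph V} {ℓ : ℕ} {s : V → Fin ℓ}
    (hs : IsProperColoring G s) : ReachableWithin G 0 s s :=
  ⟨0, le_rfl, fun _ => s, rfl, rfl, fun _ => hs, fun i => i.elim0⟩

theorem ReachableWithin.cons {V : Type} {G : SimpleGraph V} {ℓ m : ℕ} {s s' t : V → Fin ℓ}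
    (h : ReachableWithin G m s' t) (hs : IsProperColoring G s) (u : V)
    (hu : ∀ x, x ≠ u → s x = s' x) : ReachableWithin G (m + 1) s t := by
  by_cases heq : s u = s' u
  · obtain rfl : s = s' := by
      funext x
      by_cases hx : x = u
      · rw [hx, heq]
      · exact hu x hx
    obtain ⟨k, hk, c, hc⟩ := h
    exact ⟨k, by omega, c, hc⟩
  · obtain ⟨k, hk, c, h0, hl, hp, hd⟩ := h
    refine ⟨k + 1, by omega, Fin.cons s c, rfl, ?_, ?_, ?_⟩
    · rw [← Fin.succ_last, Fin.cons_succ, hl]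
    · intro i
      refine Fin.cases ?_ (fun j => ?_) i
      · exact hs
      · exact hp j
    · intro i
      refine Fin.cases ?_ (fun j => ?_) i
      · refine ⟨u, ?_, fun x hx => ?_⟩
        · simpa [h0] using heq
        · by_contra hne
          exact hx (by simpa [h0] using hu x hne)
      · simpa [← Fin.succ_castSucc] using hd j

/-- If each vertex leaves its color under `s` before any neighbor takes that color under `t`,
then recoloring the vertices one at a time turns `s` into `t`. -/
theorem ReachableWithin.of_rank {V : Type} [Fintype V] {G : SimpleGraph V} {ℓ m : ℕ}
    {s t δ : V → Fin ℓ} (hs : IsProperColoring G s) (ht : IsProperColoring G t) (r : V → ℤ)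
    (hr : ∀ x y, G.Adj x y → t y = s x → r x < r y) (h : ReachableWithin G m t δ) :
    ReachableWithin G (Fintype.card V + m) s δ := by
  classical
  have key : ∀ (k : ℕ) (U : Finset V), U.card = k → (∀ w ∉ U, ∀ u ∈ U, r w ≤ r u) →
      ReachableWithin G (k + m) (fun x => if x ∈ U then s x else t x) δ := by
    intro k
    induction k with
    | zero =>
      intro U hU _
      obtain rfl := Finset.card_eq_zero.mp hU
      simpa using h
    | succ k ih =>
      intro U hU hmono
      obtain ⟨u, hu, hmin⟩ := U.exists_min_image r (Finset.card_pos.mp (by omega))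
      have := ih (U.erase u) (by rw [Finset.card_erase_of_mem hu]; omega) (by
        intro w hw x hx
        have hxU := Finset.mem_of_mem_erase hx
        by_cases hwU : w ∈ U
        · obtain rfl : w = u := by
            by_contra hne
            exact hw (Finset.mem_erase.mpr ⟨hne, hwU⟩)
          exact hmin x hxU
        · exact hmono w hwU x hxU)
      rw [Nat.add_right_comm]
      refine this.cons ?_ u fun x hx => by simp [Finset.mem_erase, hx]
      intro x y hxy
      by_cases hx : x ∈ U <;> by_cases hy : y ∈ U <;> simp only [hx, hy, if_true, if_false]
      · exact hs hxy
      · exact fun he => absurd (hr x y hxy he.symm) (not_lt.mpr (hmono y hy x hx))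
      · exact fun he => absurd (hr y x hxy.symm he) (not_lt.mpr (hmono x hx y hy))
      · exact ht hxy
  simpa using key _ Finset.univ rfl (by simp)

/-- On a closed walk `0, 1, …, n`, the coloring `s` can be turned into `t` by recoloring each
position once, in the order of an integer rank. -/
def CycleStep {ℓ : ℕ} (n : ℕ) (s t : ℕ → Fin ℓ) : Prop :=
  ∃ ρ : ℕ → ℤ, ρ 0 = 0 ∧ ρ n = 0 ∧ ∀ i < n,
    (t (i + 1) = s i → ρ i < ρ (i + 1)) ∧ (t i = s (i + 1) → ρ (i + 1) < ρ i)

/-- An orientation of a cycle that is not a rotation is induced by a rank function. -/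
theorem exists_rank_of_orientation (n : ℕ) (o : ℕ → Prop) (hp : ∃ i < n, o i)
    (hm : ∃ i < n, ¬ o i) :
    ∃ ρ : ℕ → ℤ, ρ 0 = 0 ∧ ρ n = 0 ∧ ∀ i,
      (o i → ρ i < ρ (i + 1)) ∧ (¬ o i → ρ (i + 1) < ρ i) := by
  classical
  set P : ℤ := (((Finset.range n).filter o).card : ℤ) with hP
  set M : ℤ := (((Finset.range n).filter fun i => ¬ o i).card : ℤ) with hM
  have hP0 : 0 < P := by
    obtain ⟨i, hi, h⟩ := hp
    exact Int.natCast_pos.mpr (Finset.card_pos.mpr ⟨i, by simp [hi, h]⟩)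
  have hM0 : 0 < M := by
    obtain ⟨i, hi, h⟩ := hm
    exact Int.natCast_pos.mpr (Finset.card_pos.mpr ⟨i, by simp [hi, h]⟩)
  refine ⟨fun i => ∑ j ∈ Finset.range i, if o j then M else -P, by simp, ?_, fun i => ⟨?_, ?_⟩⟩
  · simp only [Finset.sum_ite, Finset.sum_const, nsmul_eq_mul]
    rw [← hP, ← hM]; ring
  · intro h; simp only [Finset.sum_range_succ, if_pos h]; linarith
  · intro h; simp only [Finset.sum_range_succ, if_neg h]; linarith

/-- A transition along a closed walk that swaps the colors of no edge and rotates the colors in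
neither direction is realizable by recoloring each position once. -/
theorem cycleStep_of_no_swap_of_no_rotation {ℓ n : ℕ} {s t : ℕ → Fin ℓ}
    (hswap : ∀ i < n, t (i + 1) = s i → t i ≠ s (i + 1))
    (hF : ∃ i < n, t (i + 1) ≠ s i) (hB : ∃ i < n, t i ≠ s (i + 1)) : CycleStep n s t := by
  by_cases hb : ∃ i < n, t i = s (i + 1)
  · obtain ⟨ρ, h0, hn, h⟩ := exists_rank_of_orientation n (fun i => t i ≠ s (i + 1)) hB
      (by simpa using hb)
    exact ⟨ρ, h0, hn, fun i hi => ⟨fun hf => (h i).1 (hswap i hi hf),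
      fun hb => (h i).2 (by simpa using hb)⟩⟩
  push Not at hb
  by_cases hf : ∃ i < n, t (i + 1) = s i
  · obtain ⟨ρ, h0, hn, h⟩ := exists_rank_of_orientation n (fun i => t (i + 1) = s i) hf hF
    exact ⟨ρ, h0, hn, fun i hi => ⟨(h i).1, fun h' => absurd h' (hb i hi)⟩⟩
  push Not at hf
  exact ⟨0, rfl, rfl, fun i hi => ⟨fun h => absurd h (hf i hi), fun h => absurd h (hb i hi)⟩⟩

theorem exists_avoid_three {ℓ : ℕ} (hℓ : 4 ≤ ℓ) (p q r : Fin ℓ) :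
    ∃ x : Fin ℓ, x ≠ p ∧ x ≠ q ∧ x ≠ r := by
  obtain ⟨x, hx⟩ := Finset.exists_mem_notMem_of_card_lt_card (s := {p, q, r})
    (t := (Finset.univ : Finset (Fin ℓ))) (by
      have := Finset.card_le_three (a := p) (b := q) (c := r)
      simp only [Finset.card_univ, Fintype.card_fin]; omega)
  exact ⟨x, by simpa using hx⟩

/-- Intermediate colorings of a closed walk of length `n` with prescribed colors at its base. -/
def CycleBridge {ℓ : ℕ} (n : ℕ) (α β : ℕ → Fin ℓ) (a b : Fin ℓ) : Prop :=
  ∃ γ δ : ℕ → Fin ℓ, γ 0 = a ∧ γ n = a ∧ δ 0 = b ∧ δ n = b ∧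
    (∀ i < n, γ i ≠ γ (i + 1)) ∧ (∀ i < n, δ i ≠ δ (i + 1)) ∧
    CycleStep n α γ ∧ CycleStep n γ δ ∧ CycleStep n δ β

theorem cycleBridge_of_even {ℓ : ℕ} (hℓ : 4 ≤ ℓ) {n : ℕ} (hn : 2 ≤ n) (he : Even n)
    {α β : ℕ → Fin ℓ} (hαn : α n = α 0) (hβn : β n = β 0) (a b : Fin ℓ) :
    CycleBridge n α β a b := by
  choose pick hpick using exists_avoid_three hℓ
  obtain ⟨c, hc⟩ : ∃ c, c = pick (α 0) a b := ⟨_, rfl⟩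
  have hc' := hpick (α 0) a b
  rw [← hc] at hc'
  obtain ⟨γ, hγ⟩ : ∃ γ : ℕ → Fin ℓ, γ = fun i => if i = 0 ∨ i = n then a else if Odd i then c
    else pick c (α (i - 1)) (α (i + 1)) := ⟨_, rfl⟩
  obtain ⟨δ, hδ⟩ : ∃ δ : ℕ → Fin ℓ, δ = fun i => if Odd i then pick b (β (i - 1)) (β (i + 1))
    else b := ⟨_, rfl⟩
  have hγ0 : γ 0 = a := by simp [hγ]
  have hγn : γ n = a := by simp [hγ]
  have hγo : ∀ i, Odd i → γ i = c := by
    intro i hi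
    have h1 : i ≠ 0 := by rintro rfl; simp at hi
    have h2 : i ≠ n := by rintro rfl; exact (Nat.not_odd_iff_even.mpr he) hi
    simp [hγ, hi, h1, h2]
  have hγe : ∀ i, Even i → 0 < i → i < n → γ i ≠ c ∧ γ i ≠ α (i - 1) ∧ γ i ≠ α (i + 1) := by
    intro i hi h0 h1
    have : γ i = pick c (α (i - 1)) (α (i + 1)) := by
      simp [hγ, h0.ne', h1.ne, Nat.not_odd_iff_even.mpr hi]
    rw [this]; exact hpick _ _ _
  have hδe : ∀ i, Even i → δ i = b := fun i hi => by simp [hδ, Nat.not_odd_iff_even.mpr hi]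
  have hδo : ∀ i, Odd i → δ i ≠ b ∧ δ i ≠ β (i - 1) ∧ δ i ≠ β (i + 1) := by
    intro i hi
    simp only [hδ, if_pos hi]; exact hpick _ _ _
  have hn1 : Odd (n - 1) := Nat.Even.sub_odd (by omega) he odd_one
  have hnn : n - 1 + 1 = n := by omega
  have par : ∀ i < n, (Odd i ∧ (i + 1 = n ∨ Even (i + 1) ∧ 0 < i + 1 ∧ i + 1 < n)) ∨
      ((i = 0 ∨ Even i ∧ 0 < i ∧ i < n) ∧ Odd (i + 1)) := by
    intro i hi
    rcases Nat.even_or_odd i with h | h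
    · right; exact ⟨by grind, h.add_one⟩
    · left; exact ⟨h, by have := h.add_one; grind⟩
  have par2 : ∀ i, (Odd i ∧ Even (i + 1)) ∨ (Even i ∧ Odd (i + 1)) := by
    intro i
    rcases Nat.even_or_odd i with h | h
    · right; exact ⟨h, h.add_one⟩
    · left; exact ⟨h, h.add_one⟩
  refine ⟨γ, δ, hγ0, hγn, hδe 0 (by simp), hδe n he, ?_, ?_, ?_, ?_, ?_⟩
  · intro i hi
    rcases par i hi with ⟨h, h'⟩ | ⟨h, h'⟩ <;> grind
  · intro i hi
    rcases par2 i with ⟨h, h'⟩ | ⟨h, h'⟩ <;> grind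
  · refine cycleStep_of_no_swap_of_no_rotation ?_ ⟨0, by omega, ?_⟩ ⟨n - 1, by omega, ?_⟩
    · intro i hi
      rcases par i hi with ⟨h, h'⟩ | ⟨h, h'⟩ <;> grind
    · rw [hγo _ (by simp)]; exact hc'.1
    · rw [hγo _ hn1, hnn, hαn]; exact hc'.1
  · refine cycleStep_of_no_swap_of_no_rotation ?_ ⟨n - 1, by omega, ?_⟩ ⟨0, by omega, ?_⟩
    · intro i hi
      rcases par2 i with ⟨h, h'⟩ | ⟨h, h'⟩ <;> grind
    · rw [hγo _ hn1, hnn, hδe n he]; exact hc'.2.2.symm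
    · rw [hγo _ (by simp), hδe 0 (by simp)]; exact hc'.2.2.symm
  · refine cycleStep_of_no_swap_of_no_rotation ?_ ⟨n - 1, by omega, ?_⟩ ⟨0, by omega, ?_⟩
    · intro i hi
      rcases par2 i with ⟨h, h'⟩ | ⟨h, h'⟩ <;> grind
    · exact (hδo _ hn1).2.2.symm
    · exact (hδo 1 odd_one).2.1.symm

theorem cycleBridge_of_odd {ℓ : ℕ} (hℓ : 4 ≤ ℓ) {n : ℕ} (hn : 5 ≤ n) (ho : Odd n)
    {α β : ℕ → Fin ℓ} (hαn : α n = α 0) (hβn : β n = β 0) (a b : Fin ℓ) :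
    CycleBridge n α β a b := by
  choose pick hpick using exists_avoid_three hℓ
  obtain ⟨d, hd⟩ : ∃ d, d ≠ a ∧ d ≠ b ∧ d ≠ β 0 := ⟨_, hpick _ _ _⟩
  obtain ⟨c, hc⟩ : ∃ c, c ≠ α 0 ∧ c ≠ a ∧ c ≠ d := ⟨_, hpick _ _ _⟩
  obtain ⟨z, hz⟩ : ∃ z, z ≠ c ∧ z ≠ a ∧ z ≠ if α (n - 1) = c then α (n - 2) else α 0 :=
    ⟨_, hpick _ _ _⟩
  obtain ⟨y, hy⟩ : ∃ y, y ≠ c ∧ y ≠ d ∧ y ≠ β 1 := ⟨_, hpick _ _ _⟩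
  obtain ⟨w, hw⟩ : ∃ w, w ≠ d ∧ w ≠ y ∧ w ≠ if β 3 = d then β 4 else β 2 := ⟨_, hpick _ _ _⟩
  obtain ⟨γ, hγ⟩ : ∃ γ : ℕ → Fin ℓ, γ = fun i => if i = 0 ∨ i = n then a else if Odd i then c
    else if i = n - 1 then z else pick c (α (i - 1)) (α (i + 1)) := ⟨_, rfl⟩
  obtain ⟨δ, hδ⟩ : ∃ δ : ℕ → Fin ℓ, δ = fun i => if i = 0 ∨ i = n then b else if i = 1 then d
    else if i = 2 then y else if i = 3 then w else
    if Odd i then pick d (β (i - 1)) (β (i + 1)) else d := ⟨_, rfl⟩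
  have hγ0 : γ 0 = a := by simp [hγ]
  have hγn : γ n = a := by simp [hγ]
  have hδ0 : δ 0 = b := by simp [hδ]
  have hδn : δ n = b := by simp [hδ]
  have hδ1 : δ 1 = d := by simp [hδ]; omega
  have hδ2 : δ 2 = y := by simp [hδ]; omega
  have hδ3 : δ 3 = w := by simp [hδ]; omega
  have hne : Even (n - 1) := Nat.Odd.sub_odd ho odd_one
  have hγz : γ (n - 1) = z := by
    simp [hγ, Nat.not_odd_iff_even.mpr hne]; omega
  have hγo : ∀ i, Odd i → i < n → γ i = c := by
    intro i hi h2
    have h1 : i ≠ 0 := by rintro rfl; simp at hi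
    simp [hγ, hi, h1, h2.ne]
  have hγe : ∀ i, Even i → 0 < i → i < n - 1 →
      γ i ≠ c ∧ γ i ≠ α (i - 1) ∧ γ i ≠ α (i + 1) := by
    intro i hi h0 h1
    have : γ i = pick c (α (i - 1)) (α (i + 1)) := by
      have : ¬ (i = 0 ∨ i = n) ∧ i ≠ n - 1 := by omega
      simp [hγ, this, Nat.not_odd_iff_even.mpr hi]
    rw [this]; exact hpick _ _ _
  have hδe : ∀ i, Even i → 4 ≤ i → i < n → δ i = d := by
    intro i hi h4 hin
    have : ¬ (i = 0 ∨ i = n) ∧ i ≠ 1 ∧ i ≠ 2 ∧ i ≠ 3 := by omega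
    simp [hδ, Nat.not_odd_iff_even.mpr hi, this]
  have hδo : ∀ i, Odd i → 5 ≤ i → i < n → δ i ≠ d ∧ δ i ≠ β (i - 1) ∧ δ i ≠ β (i + 1) := by
    intro i hi h4 hin
    have : i ≠ 0 ∧ i ≠ n ∧ i ≠ 1 ∧ i ≠ 2 ∧ i ≠ 3 := by omega
    have : δ i = pick d (β (i - 1)) (β (i + 1)) := by simp [hδ, hi, this]
    rw [this]; exact hpick _ _ _
  have hnn : n - 1 + 1 = n := by omega
  have hnn' : n - 2 + 1 = n - 1 := by omega
  have hn2 : Odd (n - 2) := Nat.Odd.sub_even (show 2 ≤ n by omega) ho even_two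
  have edgeγ : ∀ i < n, i = 0 ∨ i = n - 1 ∨ i = n - 2 ∨
      (γ i = c ∧ γ (i + 1) ≠ c ∧ γ (i + 1) ≠ α i) ∨
      (γ (i + 1) = c ∧ γ i ≠ c ∧ γ i ≠ α (i + 1)) := by
    intro i hi
    by_cases h0 : i = 0 ∨ i = n - 1 ∨ i = n - 2
    · tauto
    rcases Nat.even_or_odd i with h | h
    · have := hγe i h (by omega) (by omega)
      exact .inr (.inr (.inr (.inr ⟨hγo _ h.add_one (by omega), this.1, this.2.2⟩)))
    · have := hγe (i + 1) h.add_one (by omega) (by omega)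
      exact .inr (.inr (.inr (.inl ⟨hγo _ h (by omega), this.1, this.2.1⟩)))
  have edgeδ : ∀ i < n, i = 0 ∨ i = 1 ∨ i = 2 ∨ i = 3 ∨ i = n - 1 ∨
      (γ i = c ∧ δ (i + 1) = d ∧ δ i ≠ d ∧ δ i ≠ β (i + 1)) ∨
      (γ (i + 1) = c ∧ δ i = d ∧ δ (i + 1) ≠ d ∧ δ (i + 1) ≠ β i) := by
    intro i hi
    by_cases h0 : i = 0 ∨ i = 1 ∨ i = 2 ∨ i = 3 ∨ i = n - 1
    · tauto
    rcases Nat.even_or_odd i with h | h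
    · have := hδo (i + 1) h.add_one (by omega) (by omega)
      exact .inr (.inr (.inr (.inr (.inr (.inr ⟨hγo _ h.add_one (by omega),
        hδe i h (by omega) (by omega), this.1, this.2.1⟩)))))
    · have h4 : i ≠ 4 := by rintro rfl; exact absurd h (by decide)
      have := hδo i h (by omega) (by omega)
      exact .inr (.inr (.inr (.inr (.inr (.inl ⟨hγo _ h (by omega),
        hδe _ h.add_one (by omega) (by omega), this.1, this.2.2⟩)))))
  have hγ1 := hγo 1 odd_one (by omega)
  have hγ3 := hγo 3 (by decide) (by omega)
  have hγ2 := hγe 2 even_two (by omega) (by omega)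
  have hγn2 := hγo (n - 2) hn2 (by omega)
  have hδ4 := hδe 4 (by decide) (by omega) (by omega)
  have hδn1 := hδe (n - 1) hne (by omega) (by omega)
  clear hγ hδ hpick hγo hγe hδo hδe
  refine ⟨γ, δ, hγ0, hγn, hδ0, hδn, ?_, ?_, ?_, ?_, ?_⟩
  · intro i hi
    rcases edgeγ i hi with rfl | rfl | rfl | h | h
    · rw [hγ0, hγ1]; exact hc.2.1.symm
    · rw [hγz, hnn, hγn]; exact hz.2.1
    · rw [hγn2, hnn', hγz]; exact hz.1.symm
    · rw [h.1]; exact h.2.1.symm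
    · rw [h.1]; exact h.2.1
  · intro i hi
    rcases edgeδ i hi with rfl | rfl | rfl | rfl | rfl | h | h
    · rw [hδ0, hδ1]; exact hd.2.1.symm
    · rw [hδ1, hδ2]; exact hy.2.1.symm
    · rw [hδ2, hδ3]; exact hw.2.1.symm
    · rw [hδ3, hδ4]; exact hw.1
    · rw [hδn1, hnn, hδn]; exact hd.2.1
    · rw [h.2.1]; exact h.2.2.1
    · rw [h.2.1]; exact h.2.2.1.symm
  · refine cycleStep_of_no_swap_of_no_rotation ?_ ⟨0, by omega, ?_⟩ ⟨2, by omega, ?_⟩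
    · intro i hi
      rcases edgeγ i hi with rfl | rfl | rfl | h | h
      · intro h'; rw [hγ1] at h'; exact absurd h' hc.1
      · rw [hγz, hnn, hγn, hαn]
        intro h'
        rw [if_neg (h' ▸ hc.2.1.symm)] at hz
        exact hz.2.2
      · rw [hγn2, hnn', hγz]
        intro h' h''
        rw [if_pos h''.symm] at hz
        exact hz.2.2 h'
      · exact fun h' => absurd h' h.2.2
      · exact fun _ => h.2.2
    · rw [hγ1]; exact hc.1
    · exact hγ2.2.2
  · refine cycleStep_of_no_swap_of_no_rotation ?_ ⟨0, by omega, ?_⟩ ⟨n - 1, by omega, ?_⟩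
    · intro i hi
      rcases edgeδ i hi with rfl | rfl | rfl | rfl | rfl | h | h
      · rw [hδ1, hγ0]; exact fun h' => absurd h' hd.1
      · rw [hδ2, hγ1]; exact fun h' => absurd h' hy.1
      · rw [hδ2, hγ3]; exact fun _ => hy.1
      · rw [hδ4, hγ3]; exact fun h' => absurd h'.symm hc.2.2
      · rw [hδn1, hnn, hγn]; exact fun _ => hd.1
      · rw [h.1, h.2.1]; exact fun h' => absurd h'.symm hc.2.2
      · rw [h.1, h.2.1]; exact fun _ => hc.2.2.symm
    · rw [hδ1, hγ0]; exact hd.1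
    · rw [hδn1, hnn, hγn]; exact hd.1
  · refine cycleStep_of_no_swap_of_no_rotation ?_ ⟨n - 1, by omega, ?_⟩ ⟨0, by omega, ?_⟩
    · intro i hi
      rcases edgeδ i hi with rfl | rfl | rfl | rfl | rfl | h | h
      · rw [hδ1]; exact fun _ => hd.2.2.symm
      · rw [hδ2]; exact fun _ => hy.2.2.symm
      · rw [hδ2, hδ3]
        intro h'
        rw [if_neg (h' ▸ hy.2.1)] at hw
        exact hw.2.2.symm
      · rw [hδ3, hδ4]
        intro h' h''
        rw [if_pos h''] at hw
        exact hw.2.2 h'.symm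
      · rw [hδn1, hnn, hβn]; exact fun h' => absurd h'.symm hd.2.2
      · exact fun h' => absurd h'.symm h.2.2.2
      · exact fun _ => h.2.2.2.symm
    · rw [hδn1, hnn, hβn]; exact hd.2.2.symm
    · rw [hδ1]; exact hd.2.2.symm

/-- No edge of a triangle is swapped between the colorings `s` and `t`, and `t` is not a
rotation of `s`. -/
def TriangleStep {κ : Type} (s₀ s₁ s₂ t₀ t₁ t₂ : κ) : Prop :=
  ¬ (t₁ = s₀ ∧ t₀ = s₁) ∧ ¬ (t₂ = s₁ ∧ t₁ = s₂) ∧ ¬ (t₀ = s₂ ∧ t₂ = s₀) ∧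
    ¬ (t₁ = s₀ ∧ t₂ = s₁ ∧ t₀ = s₂) ∧ ¬ (t₀ = s₁ ∧ t₁ = s₂ ∧ t₂ = s₀)

instance {κ : Type} [DecidableEq κ] (s₀ s₁ s₂ t₀ t₁ t₂ : κ) :
    Decidable (TriangleStep s₀ s₁ s₂ t₀ t₁ t₂) := by
  unfold TriangleStep; infer_instance

/-- Intermediate colorings of a triangle with prescribed colors at its base. -/
def TriangleBridge {κ : Type} (α₀ α₁ α₂ β₀ β₁ β₂ a b : κ) : Prop :=
  ∃ γ₁ γ₂ δ₁ δ₂ : κ, (a ≠ γ₁ ∧ γ₁ ≠ γ₂ ∧ γ₂ ≠ a) ∧ (b ≠ δ₁ ∧ δ₁ ≠ δ₂ ∧ δ₂ ≠ b) ∧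
    TriangleStep α₀ α₁ α₂ a γ₁ γ₂ ∧ TriangleStep a γ₁ γ₂ b δ₁ δ₂ ∧
    TriangleStep b δ₁ δ₂ β₀ β₁ β₂

theorem cycleStep_three {ℓ : ℕ} {s t : ℕ → Fin ℓ} (hs : s 3 = s 0) (ht : t 3 = t 0)
    (h : TriangleStep (s 0) (s 1) (s 2) (t 0) (t 1) (t 2)) : CycleStep 3 s t := by
  obtain ⟨h0, h1, h2, hF, hB⟩ := h
  refine cycleStep_of_no_swap_of_no_rotation ?_ ?_ ?_
  · intro i hi
    interval_cases i
    · exact fun h h' => h0 ⟨h, h'⟩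
    · exact fun h h' => h1 ⟨h, h'⟩
    · rw [hs, ht]; exact fun h h' => h2 ⟨h, h'⟩
  · by_contra! h
    exact hF ⟨h 0 (by simp), h 1 (by simp), ht ▸ h 2 (by simp)⟩
  · by_contra! h
    exact hB ⟨h 0 (by simp), h 1 (by simp), hs ▸ h 2 (by simp)⟩

set_option maxRecDepth 100000 in
theorem triangleBridge_fin_four : ∀ α₁ α₂ β₁ β₂ : Fin 4, α₁ ≠ 0 → α₂ ≠ 0 → α₁ ≠ α₂ →
    β₁ ≠ 0 → β₂ ≠ 0 → β₁ ≠ β₂ → TriangleBridge 0 α₁ α₂ 0 β₁ β₂ 1 2 := by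
  unfold TriangleBridge
  decide

theorem injective_vecCons_four {κ : Type} {p q r s : κ} (hpq : p ≠ q) (hpr : p ≠ r) (hps : p ≠ s)
    (hqr : q ≠ r) (hqs : q ≠ s) (hrs : r ≠ s) : Function.Injective ![p, q, r, s] := by
  intro i j hij
  fin_cases i <;> fin_cases j <;> simp_all

theorem triangleBridge {ℓ : ℕ} (hℓ : 4 ≤ ℓ) {α₀ α₁ α₂ β₀ β₁ β₂ : Fin ℓ}
    (hα₁ : α₀ ≠ α₁) (hα : α₁ ≠ α₂) (hα₂ : α₂ ≠ α₀)
    (hβ₁ : β₀ ≠ β₁) (hβ : β₁ ≠ β₂) (hβ₂ : β₂ ≠ β₀) (a b : Fin ℓ) :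
    TriangleBridge α₀ α₁ α₂ β₀ β₁ β₂ a b := by
  have pick := exists_avoid_three hℓ
  generalize Fin ℓ = κ at *
  by_cases h : ∃ c d, (c ≠ α₀ ∧ c ≠ a ∧ c ≠ b) ∧ (d ≠ a ∧ d ≠ b ∧ d ≠ β₀) ∧ c ≠ d
  · obtain ⟨c, d, hc, hd, hcd⟩ := h
    obtain ⟨z, hzc, hza, hz₁, hz₀⟩ : ∃ z, z ≠ c ∧ z ≠ a ∧ (α₂ = c → z ≠ α₁) ∧
        (α₂ = a ∨ α₁ = a → z ≠ α₀) := by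
      by_cases h₁ : α₂ = c
      · by_cases h₂ : α₁ = a
        · obtain ⟨z, hz⟩ := pick c a α₀
          exact ⟨z, hz.1, hz.2.1, fun _ => h₂ ▸ hz.2.1, fun _ => hz.2.2⟩
        · obtain ⟨z, hz⟩ := pick c a α₁
          exact ⟨z, hz.1, hz.2.1, fun _ => hz.2.2, by grind⟩
      · obtain ⟨z, hz⟩ := pick c a α₀
        exact ⟨z, hz.1, hz.2.1, by grind, fun _ => hz.2.2⟩
    obtain ⟨x, hxd, hxb, hx₂, hx₀⟩ : ∃ x, x ≠ d ∧ x ≠ b ∧ (β₁ = d → x ≠ β₂) ∧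
        (β₁ = b ∨ β₂ = b → x ≠ β₀) := by
      by_cases h₁ : β₁ = d
      · by_cases h₂ : β₂ = b
        · obtain ⟨z, hz⟩ := pick d b β₀
          exact ⟨z, hz.1, hz.2.1, fun _ => h₂ ▸ hz.2.1, fun _ => hz.2.2⟩
        · obtain ⟨z, hz⟩ := pick d b β₂
          exact ⟨z, hz.1, hz.2.1, fun _ => hz.2.2, by grind⟩
      · obtain ⟨z, hz⟩ := pick d b β₀
        exact ⟨z, hz.1, hz.2.1, by grind, fun _ => hz.2.2⟩
    clear pick
    refine ⟨c, z, x, d, ⟨hc.2.1.symm, hzc.symm, hza⟩, ⟨hxb.symm, hxd, hd.2.1⟩, ?_, ?_, ?_⟩ <;>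
      unfold TriangleStep <;> grind
  · push Not at h
    obtain ⟨e, he⟩ := pick α₀ a b
    have he' : e ≠ β₀ := by
      obtain ⟨d, hd⟩ := pick a b β₀
      rw [h e d he hd]; exact hd.2.2
    have hall : ∀ x, x = α₀ ∨ x = a ∨ x = b ∨ x = e := by
      intro x
      by_contra! hx
      exact hx.2.2.2 (h x e ⟨hx.1, hx.2.1, hx.2.2.1⟩ ⟨he.2.1, he.2.2, he'⟩)
    have hall' : ∀ x, x = a ∨ x = b ∨ x = β₀ ∨ x = e := by
      intro x
      by_contra! hx
      exact hx.2.2.2 (h e x he ⟨hx.1, hx.2.1, hx.2.2.1⟩).symm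
    have hab : a ≠ b := by
      rintro rfl
      obtain ⟨x, hx⟩ := pick α₀ a e
      have := hall x; tauto
    have hAa : α₀ ≠ a := by
      rintro rfl
      obtain ⟨x, hx⟩ := pick α₀ b e
      have := hall x; tauto
    have hAb : α₀ ≠ b := by
      rintro rfl
      obtain ⟨x, hx⟩ := pick α₀ a e
      have := hall x; tauto
    have hAB : β₀ = α₀ := by
      have := hall' α₀
      have := he.1
      grind
    subst hAB
    obtain ⟨f, hf⟩ : ∃ f : Fin 4 → κ, f = ![β₀, a, b, e] := ⟨_, rfl⟩
    have hinj : Function.Injective f :=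
      hf ▸ injective_vecCons_four hAa hAb he.1.symm hab he.2.1.symm he.2.2.symm
    have hsurj : Function.Surjective f := by
      intro x
      rcases hall x with h | h | h | h
      · exact ⟨0, by simp [hf, h]⟩
      · exact ⟨1, by simp [hf, h]⟩
      · exact ⟨2, by simp [hf, h]⟩
      · exact ⟨3, by simp [hf, h]⟩
    have h0 : β₀ = f 0 := by simp [hf]
    have h1 : a = f 1 := by simp [hf]
    have h2 : b = f 2 := by simp [hf]
    obtain ⟨α₁, rfl⟩ := hsurj α₁
    obtain ⟨α₂, rfl⟩ := hsurj α₂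
    obtain ⟨β₁, rfl⟩ := hsurj β₁
    obtain ⟨β₂, rfl⟩ := hsurj β₂
    rw [h0] at hα₁ hα₂ hβ₁ hβ₂
    obtain ⟨γ₁, γ₂, δ₁, δ₂, h⟩ := triangleBridge_fin_four α₁ α₂ β₁ β₂
      (hinj.ne_iff.1 hα₁).symm (hinj.ne_iff.1 hα₂) (hinj.ne_iff.1 hα)
      (hinj.ne_iff.1 hβ₁).symm (hinj.ne_iff.1 hβ₂) (hinj.ne_iff.1 hβ)
    refine ⟨f γ₁, f γ₂, f δ₁, f δ₂, ?_⟩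
    rw [h0, h1, h2]
    simpa only [TriangleStep, hinj.ne_iff, hinj.eq_iff] using h

theorem cycleBridge {ℓ : ℕ} (hℓ : 4 ≤ ℓ) {n : ℕ} (hn : 2 ≤ n)
    {α β : ℕ → Fin ℓ} (hαn : α n = α 0) (hβn : β n = β 0)
    (hα : ∀ i < n, α i ≠ α (i + 1)) (hβ : ∀ i < n, β i ≠ β (i + 1)) (a b : Fin ℓ) :
    CycleBridge n α β a b := by
  rcases Nat.even_or_odd n with he | ho
  · exact cycleBridge_of_even hℓ hn he hαn hβn a b
  by_cases h5 : 5 ≤ n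
  · exact cycleBridge_of_odd hℓ h5 ho hαn hβn a b
  obtain rfl : n = 3 := by
    have : n ≠ 2 := by rintro rfl; exact absurd ho (by decide)
    have : n ≠ 4 := by rintro rfl; exact absurd ho (by decide)
    omega
  obtain ⟨γ₁, γ₂, δ₁, δ₂, hγ, hδ, h₁, h₂, h₃⟩ := triangleBridge hℓ
    (hα 0 (by simp)) (hα 1 (by simp)) (hαn ▸ hα 2 (by simp))
    (hβ 0 (by simp)) (hβ 1 (by simp)) (hβn ▸ hβ 2 (by simp)) a b
  obtain ⟨γ, hγ0, hγ1, hγ2, hγ3⟩ : ∃ γ : ℕ → Fin ℓ, γ 0 = a ∧ γ 1 = γ₁ ∧ γ 2 = γ₂ ∧ γ 3 = a :=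
    ⟨fun i => if i = 1 then γ₁ else if i = 2 then γ₂ else a, by simp⟩
  obtain ⟨δ, hδ0, hδ1, hδ2, hδ3⟩ : ∃ δ : ℕ → Fin ℓ, δ 0 = b ∧ δ 1 = δ₁ ∧ δ 2 = δ₂ ∧ δ 3 = b :=
    ⟨fun i => if i = 1 then δ₁ else if i = 2 then δ₂ else b, by simp⟩
  refine ⟨γ, δ, hγ0, hγ3, hδ0, hδ3, ?_, ?_, cycleStep_three hαn (by simp [*]) ?_,
    cycleStep_three (by simp [*]) (by simp [*]) ?_, cycleStep_three (by simp [*]) hβn ?_⟩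
  · intro i hi
    interval_cases i
    · rw [hγ0, hγ1]; exact hγ.1
    · rw [hγ1, hγ2]; exact hγ.2.1
    · rw [hγ2, hγ3]; exact hγ.2.2
  · intro i hi
    interval_cases i
    · rw [hδ0, hδ1]; exact hδ.1
    · rw [hδ1, hδ2]; exact hδ.2.1
    · rw [hδ2, hδ3]; exact hδ.2.2
  · rwa [hγ0, hγ1, hγ2]
  · rwa [hγ0, hγ1, hγ2, hδ0, hδ1, hδ2]
  · rwa [hδ0, hδ1, hδ2]

/-- In a graph whose edges lie on at most one cycle each, distinct vertices of a cycle are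
separated by removing the edges of that cycle. -/
theorem EdgeOnAtMostOneCycle.eq_of_reachable {V : Type} {G : SimpleGraph V}
    (hG : EdgeOnAtMostOneCycle G) {x y : V} {c : G.Walk x x} (hc : c.IsCycle)
    (hy : y ∈ c.support) (h : (G.deleteEdges {e | e ∈ c.edges}).Reachable x y) : x = y := by
  classical
  by_contra hxy
  cases c with
  | nil => simp at hc
  | @cons _ x₁ _ hadj q =>
    have hq : y ∈ q.support := by
      rcases List.mem_cons.mp (Walk.support_cons hadj q ▸ hy) with rfl | h'
      · exact absurd rfl hxy
      · exact h'
    rw [Walk.cons_isCycle_iff] at hc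
    have hnodup : (q.takeUntil y hq).edges.Nodup ∧ (q.dropUntil y hq).edges.Nodup ∧
        (q.takeUntil y hq).edges.Disjoint (q.dropUntil y hq).edges := by
      have := hc.1.isTrail.edges_nodup
      rwa [← q.take_spec hq, Walk.edges_append, List.nodup_append'] at this
    obtain ⟨f, hf⟩ : ∃ f, f ∈ (q.dropUntil y hq).edges := by
      by_contra! hne
      have : (q.dropUntil y hq).edges = [] := List.eq_nil_iff_forall_not_mem.mpr hne
      exact hxy (Walk.edges_eq_nil.mp this).eq.symm
    have hfq : f ∈ q.edges := q.edges_dropUntil_subset_edges hq hf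
    have hef : s(x, x₁) ≠ f := by
      rintro rfl
      exact hc.2 hfq
    have hreach : ((G.deleteEdges {f}).deleteEdges {s(x, x₁)}).Reachable x x₁ := by
      refine Reachable.trans (v := y) (h.mono ?_) ?_
      · intro p r hpr
        simp only [deleteEdges_adj, Set.mem_ofPred_eq, Set.mem_singleton_iff, Walk.edges_cons,
          List.mem_cons, not_or] at hpr ⊢
        refine ⟨⟨hpr.1, ?_⟩, hpr.2.1⟩
        rintro rfl
        exact hpr.2.2 hfq
      · rw [deleteEdges_deleteEdges]
        refine ⟨((q.takeUntil y hq).toDeleteEdges _ ?_).reverse⟩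
        rintro e he (rfl | rfl)
        · exact hnodup.2.2 he hf
        · exact hc.2 (q.edges_takeUntil_subset_edges hq he)
    obtain ⟨z, p, hp, hep⟩ := adj_and_reachable_delete_edges_iff_exists_cycle.mp
      ⟨show (G.deleteEdges {f}).Adj x x₁ by simp [hadj, hef], hreach⟩
    have hle : G.deleteEdges {f} ≤ G := deleteEdges_le _
    have hfp := (hG _ _ (Walk.cons hadj q) (p.mapLe hle)
      ((Walk.cons_isCycle_iff _ _).mpr hc) (hp.mapLe hle) s(x, x₁) (by simp)
      (by rwa [Walk.edges_mapLe_eq_edges]) f).mp (by simp [hfq])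
    rw [Walk.edges_mapLe_eq_edges] at hfp
    simpa using p.edges_subset_edgeSet hfp

/-- The closed vertex sequence `u 0, …, u n` is a bridge traversed back and forth or a cycle,
and removing its edges separates its vertices. -/
structure IsSeparatedClosedSeq {V : Type} (G : SimpleGraph V) (n : ℕ) (u : ℕ → V) : Prop where
  two_le : 2 ≤ n
  closed : u n = u 0
  inj : ∀ i < n, ∀ j < n, u i = u j → i = j
  adj : ∀ i < n, G.Adj (u i) (u (i + 1))
  eq_of_reachable : ∀ i < n, ∀ j < n,
    (G.deleteEdges {e | ∃ k < n, s(u k, u (k + 1)) = e}).Reachable (u i) (u j) → u i = u j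

theorem EdgeOnAtMostOneCycle.exists_isSeparatedClosedSeq {V : Type} {G : SimpleGraph V}
    (hG : EdgeOnAtMostOneCycle G) {v w : V} (hvw : G.Adj v w) :
    ∃ n u, IsSeparatedClosedSeq G n u ∧ u 0 = v ∧ ∃ j, 0 < j ∧ j < n ∧ u j = w := by
  classical
  by_cases hb : (G.deleteEdges {s(v, w)}).Reachable v w
  · obtain ⟨x, p, hp, hvwp⟩ := adj_and_reachable_delete_edges_iff_exists_cycle.mp ⟨hvw, hb⟩
    have hv := p.fst_mem_support_of_mem_edges hvwp
    obtain ⟨c, hc, hwc⟩ : ∃ c : G.Walk v v, c.IsCycle ∧ w ∈ c.support :=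
      ⟨p.rotate v hv, hp.rotate hv,
        Walk.snd_mem_support_of_mem_edges _ ((p.rotate_edges v hv).mem_iff.mpr hvwp)⟩
    have h3 := hc.three_le_length
    have hedge : {e | ∃ k < c.length, s(c.getVert k, c.getVert (k + 1)) = e} =
        {e | e ∈ c.edges} := by
      ext ⟨p, q⟩
      exact (c.mk_mem_edges_iff_exists).symm
    refine ⟨c.length, c.getVert, ⟨by omega, by simp, ?_, ?_, ?_⟩, by simp, ?_⟩
    · intro i hi j hj
      exact hc.getVert_injOn' (show i ≤ _ by omega) (show j ≤ _ by omega)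
    · exact fun i hi => c.adj_getVert_succ hi
    · intro i hi j hj h
      rw [hedge] at h
      have hi' := c.getVert_mem_support i
      have hrot : ∀ e, e ∈ (c.rotate _ hi').edges ↔ e ∈ c.edges :=
        fun e => (c.rotate_edges _ hi').mem_iff
      refine hG.eq_of_reachable (hc.rotate hi') ?_ (by simpa only [hrot] using h)
      rw [Walk.mem_support_rotate_iff]
      exact c.getVert_mem_support j
    · obtain ⟨j, rfl, hj⟩ := Walk.mem_support_iff_exists_getVert.mp hwc
      have h0 : j ≠ 0 := by
        rintro rfl
        simp at hvw
      have hn : j ≠ c.length := by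
        rintro rfl
        simp at hvw
      exact ⟨j, by omega, by omega, rfl⟩
  · have hedge : {e | ∃ k < 2, s((if k = 1 then w else v), (if k + 1 = 1 then w else v)) = e} =
        {s(v, w)} := by
      ext e
      simp only [Set.mem_ofPred_eq, Set.mem_singleton_iff]
      constructor
      · rintro ⟨k, hk, rfl⟩
        interval_cases k <;> simp [Sym2.eq_swap]
      · rintro rfl
        exact ⟨0, by simp⟩
    refine ⟨2, fun i => if i = 1 then w else v, ⟨le_rfl, by simp, ?_, ?_, ?_⟩, by simp, 1, by simp⟩
    · intro i hi j hj
      interval_cases i <;> interval_cases j <;> simp [hvw.ne, hvw.ne']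
    · intro i hi
      interval_cases i <;> simp [hvw, hvw.symm]
    · intro i hi j hj h
      rw [hedge] at h
      interval_cases i <;> interval_cases j <;> simp_all
      exact absurd h.symm hb

/-- The edges of `G` with at least one end outside `S`. -/
def outerEdges {V : Type} (G : SimpleGraph V) (S : Set V) : SimpleGraph V where
  Adj x y := G.Adj x y ∧ ¬ (x ∈ S ∧ y ∈ S)
  symm := ⟨fun _ _ h => ⟨h.1.symm, fun h' => h.2 ⟨h'.2, h'.1⟩⟩⟩
  loopless := ⟨fun _ h => h.1.ne rfl⟩

theorem outerEdges_anti {V : Type} (G : SimpleGraph V) {S T : Set V} (h : S ⊆ T) :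
    outerEdges G T ≤ outerEdges G S :=
  fun _ _ h' => ⟨h'.1, fun h'' => h'.2 ⟨h h''.1, h h''.2⟩⟩

/-- Distinct vertices of `S` are not joined by edges having an end outside `S`. -/
def IsOuterSeparated {V : Type} (G : SimpleGraph V) (S : Set V) : Prop :=
  ∀ x ∈ S, ∀ y ∈ S, (outerEdges G S).Reachable x y → x = y

theorem reachable_of_forall_adj_succ {V : Type} {H : SimpleGraph V} {u : ℕ → V} {i j : ℕ}
    (hij : i ≤ j) (h : ∀ k, i ≤ k → k < j → H.Adj (u k) (u (k + 1))) :
    H.Reachable (u i) (u j) := by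
  induction j, hij using Nat.le_induction with
  | base => rfl
  | succ j hij ih =>
    exact (ih fun k hk hkj => h k hk (by omega)).trans (h j hij (by omega)).reachable

namespace IsSeparatedClosedSeq

variable {V : Type} {G : SimpleGraph V} {n : ℕ} {u : ℕ → V} {S : Set V}

theorem notMem_of_notMem (hu : IsSeparatedClosedSeq G n u) (hS : IsOuterSeparated G S)
    (h0 : u 0 ∈ S) {j : ℕ} (hjn : j < n) (hj : u j ∉ S) :
    ∀ i, 0 < i → i < n → u i ∉ S := by
  classical
  have hn : ∃ k, j ≤ k ∧ u k ∈ S := ⟨n, hjn.le, hu.closed ▸ h0⟩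
  obtain ⟨b, hb⟩ : ∃ b, b = Nat.find hn := ⟨_, rfl⟩
  obtain ⟨a, ha⟩ : ∃ a, a = Nat.findGreatest (fun k => u k ∈ S) j := ⟨_, rfl⟩
  have hbS : j ≤ b ∧ u b ∈ S := hb ▸ Nat.find_spec hn
  have hbn : b ≤ n := hb ▸ Nat.find_min' hn ⟨hjn.le, hu.closed ▸ h0⟩
  have haS : u a ∈ S := ha ▸ Nat.findGreatest_spec (P := fun k => u k ∈ S) (zero_le) h0
  have haj : a ≤ j := ha ▸ Nat.findGreatest_le j
  have hne : a ≠ j := by rintro rfl; exact hj haS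
  have hne' : b ≠ j := by rintro rfl; exact hj hbS.2
  have hmid : ∀ k, a < k → k < b → u k ∉ S := by
    intro k hak hkb
    rcases le_total k j with hk | hk
    · exact Nat.findGreatest_is_greatest (ha ▸ hak) hk
    · exact fun h => Nat.find_min hn (hb ▸ hkb) ⟨hk, h⟩
  have hab : u a = u b := by
    refine hS _ haS _ hbS.2 (reachable_of_forall_adj_succ (by omega) fun k hak hkb => ?_)
    refine ⟨hu.adj k (by omega), fun h => ?_⟩
    by_cases hk : a < k
    · exact hmid k hk hkb h.1
    · exact hmid (k + 1) (by omega) (by omega) h.2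
  have hbn' : b = n := by
    by_contra hbne
    have := hu.inj a (by omega) b (by omega) hab
    omega
  have ha0 : a = 0 := hu.inj a (by omega) 0 (by omega) (by rw [hab, hbn', hu.closed])
  subst hbn' ha0
  exact hmid

theorem reachable_outerEdges (hu : IsSeparatedClosedSeq G n u)
    (hout : ∀ i, 0 < i → i < n → u i ∉ S) {i : ℕ} (hi : i < n) :
    (outerEdges G S).Reachable (u 0) (u i) :=
  reachable_of_forall_adj_succ (zero_le) fun k _ hk =>
    ⟨hu.adj k (by omega), fun h => hout (k + 1) (by omega) (by omega) h.2⟩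

theorem mem_range_of_reachable (hu : IsSeparatedClosedSeq G n u) (hS : IsOuterSeparated G S)
    (h0 : u 0 ∈ S) (hout : ∀ i, 0 < i → i < n → u i ∉ S) {x y : V}
    (hx : x ∈ S ∪ {x | ∃ i < n, u i = x}) (hy : y ∈ S ∪ {x | ∃ i < n, u i = x})
    (hxy : (outerEdges G S).Reachable x y) :
    x = y ∨ (∃ i < n, u i = x) ∧ ∃ i < n, u i = y := by
  have h0n : 0 < n := by have := hu.two_le; omega
  rcases hx with hx | ⟨i, hi, rfl⟩ <;> rcases hy with hy | ⟨j, hj, rfl⟩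
  · exact .inl (hS x hx y hy hxy)
  · exact .inr ⟨⟨0, h0n, hS _ h0 _ hx ((hu.reachable_outerEdges hout hj).trans hxy.symm)⟩,
      j, hj, rfl⟩
  · exact .inr ⟨⟨i, hi, rfl⟩, 0, h0n,
      hS _ h0 _ hy ((hu.reachable_outerEdges hout hi).trans hxy)⟩
  · exact .inr ⟨⟨i, hi, rfl⟩, j, hj, rfl⟩

theorem isOuterSeparated_union (hu : IsSeparatedClosedSeq G n u) (hS : IsOuterSeparated G S)
    (h0 : u 0 ∈ S) (hout : ∀ i, 0 < i → i < n → u i ∉ S) :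
    IsOuterSeparated G (S ∪ {x | ∃ i < n, u i = x}) := by
  intro x hx y hy hxy
  rcases hu.mem_range_of_reachable hS h0 hout hx hy
    (hxy.mono (outerEdges_anti G Set.subset_union_left)) with h | ⟨⟨i, hi, rfl⟩, j, hj, rfl⟩
  · exact h
  refine hu.eq_of_reachable i hi j hj (hxy.mono fun p q hpq => ?_)
  rw [deleteEdges_adj]
  refine ⟨hpq.1, ?_⟩
  rintro ⟨k, hk, hkpq⟩
  have hk1 : u k ∈ S ∪ {x | ∃ i < n, u i = x} := .inr ⟨k, hk, rfl⟩
  have hk2 : u (k + 1) ∈ S ∪ {x | ∃ i < n, u i = x} := by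
    rcases (show k + 1 ≤ n by omega).lt_or_eq with h | h
    · exact .inr ⟨k + 1, h, rfl⟩
    · rw [h, hu.closed]; exact .inl h0
  rcases Sym2.eq_iff.mp hkpq with ⟨rfl, rfl⟩ | ⟨rfl, rfl⟩
  · exact hpq.2 ⟨hk1, hk2⟩
  · exact hpq.2 ⟨hk2, hk1⟩

theorem mem_or_consecutive_of_adj (hu : IsSeparatedClosedSeq G n u) (hS : IsOuterSeparated G S)
    (h0 : u 0 ∈ S) (hout : ∀ i, 0 < i → i < n → u i ∉ S) {x y : V}
    (hx : x ∈ S ∪ {x | ∃ i < n, u i = x}) (hy : y ∈ S ∪ {x | ∃ i < n, u i = x})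
    (hxy : G.Adj x y) : (x ∈ S ∧ y ∈ S) ∨
      ∃ i < n, (x = u i ∧ y = u (i + 1)) ∨ (y = u i ∧ x = u (i + 1)) := by
  by_contra! hcon
  rcases hu.mem_range_of_reachable hS h0 hout hx hy
    (Adj.reachable (G := outerEdges G S) ⟨hxy, fun h => hcon.1 h.1 h.2⟩) with
    h | ⟨⟨i, hi, rfl⟩, j, hj, rfl⟩
  · exact hxy.ne h
  refine hxy.ne (hu.eq_of_reachable i hi j hj (Adj.reachable ?_))
  rw [deleteEdges_adj]
  refine ⟨hxy, ?_⟩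
  rintro ⟨k, hk, he⟩
  rcases Sym2.eq_iff.mp he with ⟨h, h'⟩ | ⟨h, h'⟩
  · exact (hcon.2 k hk).1 h.symm h'.symm
  · exact (hcon.2 k hk).2 h.symm h'.symm

theorem exists_extension (hu : IsSeparatedClosedSeq G n u)
    (hout : ∀ i, 0 < i → i < n → u i ∉ S) {κ : Type} (f : V → κ) {g : ℕ → κ}
    (hg0 : g 0 = f (u 0)) (hgn : g n = f (u 0)) :
    ∃ f' : V → κ, (∀ x ∈ S, f' x = f x) ∧ ∀ i ≤ n, f' (u i) = g i := by
  classical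
  refine ⟨fun x => if x ∈ S then f x else if h : ∃ i < n, u i = x then g h.choose else f x,
    fun x hx => if_pos hx, fun i hi => ?_⟩
  have h0n : 0 < n := by have := hu.two_le; omega
  have main : ∀ i < n, (if u i ∈ S then f (u i) else
      if h : ∃ k < n, u k = u i then g h.choose else f (u i)) = g i := by
    intro i hi
    by_cases hiS : u i ∈ S
    · obtain rfl : i = 0 := by
        by_contra hne
        exact hout i (by omega) hi hiS
      rw [if_pos hiS, hg0]
    · have h : ∃ k < n, u k = u i := ⟨i, hi, rfl⟩
      rw [if_neg hiS, dif_pos h, hu.inj _ h.choose_spec.1 i hi h.choose_spec.2]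
  rcases hi.lt_or_eq with h | rfl
  · exact main i h
  · simp only [hu.closed]
    rw [main 0 h0n, hgn, hg0]

end IsSeparatedClosedSeq

/-- Inside `S`, each vertex can be recolored once, in the order of an integer rank, to turn `s`
into `t`. -/
def StepOn {V : Type} (G : SimpleGraph V) {ℓ : ℕ} (S : Set V) (s t : V → Fin ℓ) : Prop :=
  ∃ r : V → ℤ, ∀ x ∈ S, ∀ y ∈ S, G.Adj x y → t y = s x → r x < r y

/-- Inside `S`, there are two intermediate proper colorings such that one recoloring of each vertex
suffices for each of the three resulting transitions. -/
def BridgedOn {V : Type} (G : SimpleGraph V) {ℓ : ℕ} (α β : V → Fin ℓ) (S : Set V) : Prop :=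
  ∃ γ δ : V → Fin ℓ, (∀ x ∈ S, ∀ y ∈ S, G.Adj x y → γ x ≠ γ y) ∧
    (∀ x ∈ S, ∀ y ∈ S, G.Adj x y → δ x ≠ δ y) ∧
    StepOn G S α γ ∧ StepOn G S γ δ ∧ StepOn G S δ β

theorem bridgedOn_singleton {V : Type} (G : SimpleGraph V) {ℓ : ℕ} (α β : V → Fin ℓ) (v : V) :
    BridgedOn G α β {v} := by
  have h : ∀ x ∈ ({v} : Set V), ∀ y ∈ ({v} : Set V), ¬ G.Adj x y := by
    rintro x rfl y rfl
    exact G.irrefl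
  exact ⟨α, α, fun x hx y hy hxy => absurd hxy (h x hx y hy),
    fun x hx y hy hxy => absurd hxy (h x hx y hy),
    ⟨0, fun x hx y hy hxy => absurd hxy (h x hx y hy)⟩,
    ⟨0, fun x hx y hy hxy => absurd hxy (h x hx y hy)⟩,
    ⟨0, fun x hx y hy hxy => absurd hxy (h x hx y hy)⟩⟩

section Extension

variable {V : Type} {G : SimpleGraph V} {n : ℕ} {u : ℕ → V} {S : Set V} {ℓ : ℕ}

theorem StepOn.union (hu : IsSeparatedClosedSeq G n u) (hS : IsOuterSeparated G S)
    (h0 : u 0 ∈ S) (hout : ∀ i, 0 < i → i < n → u i ∉ S) {s t s' t' : V → Fin ℓ} {p q : ℕ → Fin ℓ}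
    (h : StepOn G S s t) (hc : CycleStep n p q)
    (hs : ∀ x ∈ S, s' x = s x) (ht : ∀ x ∈ S, t' x = t x)
    (hp : ∀ i ≤ n, s' (u i) = p i) (hq : ∀ i ≤ n, t' (u i) = q i) :
    StepOn G (S ∪ {x | ∃ i < n, u i = x}) s' t' := by
  obtain ⟨r, hr⟩ := h
  obtain ⟨ρ, hρ0, hρn, hρ⟩ := hc
  obtain ⟨r', hr'S, hr'u⟩ := hu.exists_extension hout r (g := fun i => r (u 0) + ρ i)
    (by simp [hρ0]) (by simp [hρn])
  refine ⟨r', fun x hx y hy hxy => ?_⟩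
  rcases hu.mem_or_consecutive_of_adj hS h0 hout hx hy hxy with
    ⟨hx, hy⟩ | ⟨i, hi, ⟨rfl, rfl⟩ | ⟨rfl, rfl⟩⟩
  · rw [hs x hx, ht y hy, hr'S x hx, hr'S y hy]
    exact hr x hx y hy hxy
  · rw [hp i hi.le, hq (i + 1) hi, hr'u i hi.le, hr'u (i + 1) hi]
    intro h
    have := (hρ i hi).1 h
    linarith
  · rw [hp (i + 1) hi, hq i hi.le, hr'u i hi.le, hr'u (i + 1) hi]
    intro h
    have := (hρ i hi).2 h
    linarith

theorem proper_on_union (hu : IsSeparatedClosedSeq G n u) (hS : IsOuterSeparated G S)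
    (h0 : u 0 ∈ S) (hout : ∀ i, 0 < i → i < n → u i ∉ S) {s s' : V → Fin ℓ} {p : ℕ → Fin ℓ}
    (h : ∀ x ∈ S, ∀ y ∈ S, G.Adj x y → s x ≠ s y) (hc : ∀ i < n, p i ≠ p (i + 1))
    (hs : ∀ x ∈ S, s' x = s x) (hp : ∀ i ≤ n, s' (u i) = p i) :
    ∀ x ∈ S ∪ {x | ∃ i < n, u i = x}, ∀ y ∈ S ∪ {x | ∃ i < n, u i = x},
      G.Adj x y → s' x ≠ s' y := by
  intro x hx y hy hxy
  rcases hu.mem_or_consecutive_of_adj hS h0 hout hx hy hxy with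
    ⟨hx, hy⟩ | ⟨i, hi, ⟨rfl, rfl⟩ | ⟨rfl, rfl⟩⟩
  · rw [hs x hx, hs y hy]
    exact h x hx y hy hxy
  · rw [hp i hi.le, hp (i + 1) hi]
    exact hc i hi
  · rw [hp i hi.le, hp (i + 1) hi]
    exact (hc i hi).symm

theorem BridgedOn.union (hℓ : 4 ≤ ℓ) {α β : V → Fin ℓ} (hα : IsProperColoring G α)
    (hβ : IsProperColoring G β) (hu : IsSeparatedClosedSeq G n u) (hS : IsOuterSeparated G S)
    (h0 : u 0 ∈ S) (hout : ∀ i, 0 < i → i < n → u i ∉ S) (h : BridgedOn G α β S) :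
    BridgedOn G α β (S ∪ {x | ∃ i < n, u i = x}) := by
  obtain ⟨γ, δ, hγ, hδ, h₁, h₂, h₃⟩ := h
  obtain ⟨p, q, hp0, hpn, hq0, hqn, hp, hq, c₁, c₂, c₃⟩ := cycleBridge hℓ hu.two_le
    (α := fun i => α (u i)) (β := fun i => β (u i)) (by simp [hu.closed]) (by simp [hu.closed])
    (fun i hi => hα (hu.adj i hi)) (fun i hi => hβ (hu.adj i hi)) (γ (u 0)) (δ (u 0))
  obtain ⟨γ', hγ', hγu⟩ := hu.exists_extension hout γ hp0 hpn
  obtain ⟨δ', hδ', hδu⟩ := hu.exists_extension hout δ hq0 hqn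
  exact ⟨γ', δ', proper_on_union hu hS h0 hout hγ hp hγ' hγu,
    proper_on_union hu hS h0 hout hδ hq hδ' hδu,
    h₁.union hu hS h0 hout c₁ (fun _ _ => rfl) hγ' (fun _ _ => rfl) hγu,
    h₂.union hu hS h0 hout c₂ hγ' hδ' hγu hδu,
    h₃.union hu hS h0 hout c₃ hδ' (fun _ _ => rfl) hδu (fun _ _ => rfl)⟩

end Extension

theorem IsCactus.bridgedOn_univ {V : Type} [Finite V] {G : SimpleGraph V} (hG : IsCactus G)
    {ℓ : ℕ} (hℓ : 4 ≤ ℓ) {α β : V → Fin ℓ} (hα : IsProperColoring G α)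
    (hβ : IsProperColoring G β) : BridgedOn G α β Set.univ := by
  obtain ⟨v₀⟩ := hG.1.nonempty
  obtain ⟨S, hSmax⟩ := (Set.toFinite {S : Set V | S.Nonempty ∧ IsOuterSeparated G S ∧
    BridgedOn G α β S}).exists_maximal
    ⟨{v₀}, Set.singleton_nonempty _, by rintro x rfl y rfl _; rfl, bridgedOn_singleton G α β v₀⟩
  obtain ⟨⟨a, ha⟩, hsep, hbr⟩ := hSmax.prop
  suffices hSu : S = Set.univ from hSu ▸ hbr
  by_contra hne
  obtain ⟨b, hb⟩ := (Set.ne_univ_iff_exists_notMem S).mp hne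
  obtain ⟨p⟩ := hG.1.preconnected a b
  obtain ⟨d, -, hv, hw⟩ := p.exists_boundary_dart S ha hb
  obtain ⟨n, u, hu, hu0, j, -, hjn, hj⟩ := hG.2.exists_isSeparatedClosedSeq d.adj
  rw [← hu0] at hv
  rw [← hj] at hw
  have hout := hu.notMem_of_notMem hsep hv hjn hw
  have hle := hSmax.le_of_ge (y := S ∪ {x | ∃ i < n, u i = x})
    ⟨⟨a, .inl ha⟩, hu.isOuterSeparated_union hsep hv hout,
      hbr.union hℓ hα hβ hu hsep hv hout⟩ Set.subset_union_left
  exact hw (hle (.inr ⟨j, hjn, rfl⟩))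

theorem cactus_reconf_linear_diameter
    {V : Type} [Fintype V] (G : SimpleGraph V) (hG : IsCactus G)
    (ℓ : ℕ) (hℓ : 4 ≤ ℓ) (α β : V → Fin ℓ)
    (hα : IsProperColoring G α) (hβ : IsProperColoring G β) :
    ∃ m : ℕ, m ≤ 3 * Fintype.card V ∧
      ∃ c : Fin (m + 1) → V → Fin ℓ, IsTransformSeq G c α β := by
  obtain ⟨γ, δ, hγ, hδ, ⟨r₁, h₁⟩, ⟨r₂, h₂⟩, ⟨r₃, h₃⟩⟩ := hG.bridgedOn_univ hℓ hα hβ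
  have hγ' : IsProperColoring G γ := fun x y => hγ x trivial y trivial
  have hδ' : IsProperColoring G δ := fun x y => hδ x trivial y trivial
  obtain ⟨m, hm, c, hc⟩ := ReachableWithin.of_rank hα hγ' r₁ (fun x y => h₁ x trivial y trivial)
    (ReachableWithin.of_rank hγ' hδ' r₂ (fun x y => h₂ x trivial y trivial)
      (ReachableWithin.of_rank hδ' hβ r₃ (fun x y => h₃ x trivial y trivial)
        (ReachableWithin.refl hβ)))
  exact ⟨m, by omega, c, hc⟩
end

section
/- Let G be a finite simple graph with no K_{2,3} minor. Then there exists an independent set I of G such that in the induced subgraph G − I every edge lies on at most one cycle of G − I; that is, every connected component of G − I is a cactus graph. -/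
open SimpleGraph

/-- The spanning subgraph of `G` in which all vertices of `I` are made isolated. -/
def isolate {V : Type} (G : SimpleGraph V) (I : Set V) : SimpleGraph V where
  Adj a b := G.Adj a b ∧ a ∉ I ∧ b ∉ I
  symm := ⟨fun _ _ h => ⟨h.1.symm, h.2.2, h.2.1⟩⟩
  loopless := ⟨fun _ h => G.loopless.irrefl _ h.1⟩

theorem isolate_le {V : Type} (G : SimpleGraph V) (I : Set V) : isolate G I ≤ G :=
  fun _ _ h => h.1

section Cactus

variable {V : Type} {H H' : SimpleGraph V}

theorem EdgeOnAtMostOneCycle.edges_iff_of_subset (h : EdgeOnAtMostOneCycle H') {u v : V}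
    {p : H.Walk u u} {q : H.Walk v v} (hp : p.IsCycle) (hq : q.IsCycle)
    (hp' : ∀ e ∈ p.edges, e ∈ H'.edgeSet) (hq' : ∀ e ∈ q.edges, e ∈ H'.edgeSet)
    {e : Sym2 V} (hep : e ∈ p.edges) (heq : e ∈ q.edges) (e' : Sym2 V) :
    e' ∈ p.edges ↔ e' ∈ q.edges := by
  have := h u v (p.transfer H' hp') (q.transfer H' hq') (hp.transfer hp') (hq.transfer hq') e
    (by simpa using hep) (by simpa using heq) e'
  simpa using this

theorem EdgeOnAtMostOneCycle.mono (hle : H ≤ H') (h : EdgeOnAtMostOneCycle H') :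
    EdgeOnAtMostOneCycle H := fun _ _ p q hp hq _ hep heq e' =>
  h.edges_iff_of_subset hp hq (fun _ he => edgeSet_mono hle (p.edges_subset_edgeSet he))
    (fun _ he => edgeSet_mono hle (q.edges_subset_edgeSet he)) hep heq e'

theorem EdgeOnAtMostOneCycle.induce_compl {I : Set V}
    (h : EdgeOnAtMostOneCycle (isolate H I)) : EdgeOnAtMostOneCycle (H.induce Iᶜ) := by
  let φ : H.induce Iᶜ →g isolate H I := ⟨Subtype.val, fun {a b} hab => ⟨hab, a.2, b.2⟩⟩
  have hφ : Function.Injective φ := Subtype.val_injective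
  intro u v p q hp hq e hep heq e'
  have hinj : Function.Injective (Sym2.map φ) := Sym2.map.injective hφ
  have := h _ _ (p.map φ) (q.map φ) (hp.map hφ) (hq.map hφ) (e.map φ)
    (by rw [Walk.edges_map]; exact List.mem_map_of_mem hep)
    (by rw [Walk.edges_map]; exact List.mem_map_of_mem heq) (e'.map φ)
  rwa [Walk.edges_map, Walk.edges_map, List.mem_map_of_injective hinj,
    List.mem_map_of_injective hinj] at this

theorem mem_edgeSet_isolate_of_notMem_support {u x : V} {p : H.Walk u u} (hx : x ∉ p.support)
    (e : Sym2 V) (he : e ∈ p.edges) : e ∈ (isolate H {x}).edgeSet := by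
  induction e with | _ a b
  refine ⟨p.adj_of_mem_edges he, ?_, ?_⟩
  · rintro rfl
    exact hx (p.fst_mem_support_of_mem_edges he)
  · rintro rfl
    exact hx (p.snd_mem_support_of_mem_edges he)

theorem SimpleGraph.Walk.IsCycle.exists_ne_mem_edges [DecidableEq V] {u x : V} {p : H.Walk u u}
    (hp : p.IsCycle) (hx : x ∈ p.support) (a : V) : ∃ b, b ≠ a ∧ s(x, b) ∈ p.edges := by
  have hc := hp.rotate hx
  have he : ∀ e, e ∈ (p.rotate x hx).edges ↔ e ∈ p.edges := fun e => (p.rotate_edges x hx).mem_iff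
  by_cases h : (p.rotate x hx).snd = a
  · refine ⟨(p.rotate x hx).penultimate, ?_, ?_⟩
    · rintro rfl
      exact hc.snd_ne_penultimate h
    · rw [← he, Sym2.eq_swap]
      exact Walk.mk_penultimate_end_mem_edges hc.not_nil
  · exact ⟨_, h, (he _).1 (Walk.mk_start_snd_mem_edges hc.not_nil)⟩

theorem EdgeOnAtMostOneCycle.of_isolate_of_leaf {x a : V} (hx : ∀ y, H.Adj x y → y = a)
    (h : EdgeOnAtMostOneCycle (isolate H {x})) : EdgeOnAtMostOneCycle H := by
  classical
  have key : ∀ (u : V) (p : H.Walk u u), p.IsCycle → x ∉ p.support := by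
    intro u p hp hmem
    obtain ⟨b, hb, he⟩ := hp.exists_ne_mem_edges hmem a
    exact hb (hx b (p.adj_of_mem_edges he))
  intro u v p q hp hq e hep heq e'
  exact h.edges_iff_of_subset hp hq (mem_edgeSet_isolate_of_notMem_support (key _ _ hp))
    (mem_edgeSet_isolate_of_notMem_support (key _ _ hq)) hep heq e'

theorem edges_of_isCycle_of_pendant_triangle_of_snd {x z w : V}
    (hx : ∀ y, H.Adj x y → y = z ∨ y = w)
    (hz : ∀ y, H.Adj z y → y = x ∨ y = w) {p : H.Walk x x} (hp : p.IsCycle) (hs : p.snd = z)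
    (e : Sym2 V) : e ∈ p.edges ↔ e = s(x, z) ∨ e = s(z, w) ∨ e = s(x, w) := by
  cases p with
  | nil => exact absurd rfl hp.ne_nil
  | @cons _ a _ hxa q =>
    obtain ⟨hq, hqe⟩ := (Walk.cons_isCycle_iff _ _).1 hp
    obtain rfl : a = z := by simpa using hs
    cases q with
    | nil => exact absurd hxa (H.loopless.irrefl _)
    | @cons _ b _ hab r =>
      obtain ⟨hr, hra⟩ := (Walk.cons_isPath_iff _ _).1 hq
      have hbx : b ≠ x := by
        rintro rfl
        exact hqe (by simp [Sym2.eq_swap])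
      obtain rfl : b = w := (hz b hab).resolve_left hbx
      have hr' := hr.reverse
      have hmem : ∀ e, e ∈ r.edges ↔ e ∈ r.reverse.edges := by simp
      have hsup : ∀ e, e ∈ r.support ↔ e ∈ r.reverse.support := by simp
      rw [Walk.edges_cons, Walk.edges_cons, List.mem_cons, List.mem_cons, hmem]
      rw [hsup] at hra
      generalize r.reverse = s at *
      cases s with
      | nil => exact absurd rfl hbx
      | @cons _ c _ hc t =>
        obtain rfl | rfl := hx c hc
        · simp at hra
        · obtain rfl := Walk.isPath_iff_nil.1 ((Walk.cons_isPath_iff _ _).1 hr').1 |>.eq_nil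
          simp

theorem edges_of_isCycle_of_pendant_triangle [DecidableEq V] {u x z w : V}
    (hx : ∀ y, H.Adj x y → y = z ∨ y = w)
    (hz : ∀ y, H.Adj z y → y = x ∨ y = w) {p : H.Walk u u} (hp : p.IsCycle)
    (hxp : x ∈ p.support) (e : Sym2 V) :
    e ∈ p.edges ↔ e = s(x, z) ∨ e = s(z, w) ∨ e = s(x, w) := by
  have hc := hp.rotate hxp
  rw [← (p.rotate_edges x hxp).mem_iff]
  generalize p.rotate x hxp = q at hc
  obtain h | h := hx _ (q.adj_snd hc.not_nil)
  · exact edges_of_isCycle_of_pendant_triangle_of_snd hx hz hc h e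
  · have hpen := (hx _ (q.adj_penultimate hc.not_nil).symm).resolve_right
      fun h' => hc.snd_ne_penultimate (h.trans h'.symm)
    have := edges_of_isCycle_of_pendant_triangle_of_snd hx hz hc.reverse (by simpa using hpen) e
    simpa using this

theorem EdgeOnAtMostOneCycle.of_isolate_of_pendant_triangle {x z w : V}
    (hx : ∀ y, H.Adj x y → y = z ∨ y = w) (hz : ∀ y, H.Adj z y → y = x ∨ y = w)
    (h : EdgeOnAtMostOneCycle (isolate H {x})) : EdgeOnAtMostOneCycle H := by
  classical
  have key : ∀ (u v : V) (p : H.Walk u u) (q : H.Walk v v), p.IsCycle → q.IsCycle →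
      x ∈ p.support → ∀ e ∈ p.edges, e ∈ q.edges → x ∈ q.support := by
    intro u v p q hp hq hxp e hep heq
    by_contra hxq
    rw [edges_of_isCycle_of_pendant_triangle hx hz hp hxp] at hep
    obtain rfl | rfl | rfl := hep
    · exact hxq (q.fst_mem_support_of_mem_edges heq)
    · obtain ⟨b, hb, hb'⟩ := hq.exists_ne_mem_edges (q.fst_mem_support_of_mem_edges heq) w
      obtain rfl := (hz b (q.adj_of_mem_edges hb')).resolve_right hb
      exact hxq (q.snd_mem_support_of_mem_edges hb')
    · exact hxq (q.fst_mem_support_of_mem_edges heq)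
  intro u v p q hp hq e hep heq e'
  by_cases hxp : x ∈ p.support
  · rw [edges_of_isCycle_of_pendant_triangle hx hz hp hxp,
      edges_of_isCycle_of_pendant_triangle hx hz hq (key _ _ p q hp hq hxp e hep heq)]
  · have hxq : x ∉ q.support := fun hxq => hxp (key _ _ q p hq hp hxq e heq hep)
    exact h.edges_iff_of_subset hp hq (mem_edgeSet_isolate_of_notMem_support hxp)
      (mem_edgeSet_isolate_of_notMem_support hxq) hep heq e'

end Cactus

section Minor

variable {V W : Type} {G G' : SimpleGraph V} {H : SimpleGraph W}

theorem SimpleGraph.Connected.induce_of_adj_reachable {S T : Set V} (hST : S ⊆ T)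
    (hS : (G'.induce S).Connected)
    (hadj : ∀ a b : S, G'.Adj a b →
      (G.induce T).Reachable (Set.inclusion hST a) (Set.inclusion hST b))
    (hT : ∀ t : T, ∃ s : S, (G.induce T).Reachable t (Set.inclusion hST s)) :
    (G.induce T).Connected := by
  obtain ⟨s₀⟩ := hS.nonempty
  have key : ∀ a b : S, (G'.induce S).Walk a b →
      (G.induce T).Reachable (Set.inclusion hST a) (Set.inclusion hST b) := by
    intro a b p
    induction p with
    | nil => rfl
    | cons h _ ih => exact (hadj _ _ h).trans ih
  refine (connected_iff _).2 ⟨fun t t' => ?_, ⟨Set.inclusion hST s₀⟩⟩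
  obtain ⟨s, hs⟩ := hT t
  obtain ⟨s', hs'⟩ := hT t'
  obtain ⟨p⟩ := hS.preconnected s s'
  exact (hs.trans (key _ _ p)).trans hs'.symm

theorem IsMinor.mono (hle : G' ≤ G) (h : IsMinor H G') : IsMinor H G := by
  obtain ⟨B, hne, hd, hc, hadj⟩ := h
  refine ⟨B, hne, hd, fun i => (hc i).mono fun _ _ hab => hle hab, fun i j hij => ?_⟩
  obtain ⟨u, hu, v, hv, huv⟩ := hadj hij
  exact ⟨u, hu, v, hv, hle huv⟩

/-- Suppressing a vertex `x` by joining two of its neighbours creates no new minor without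
isolated vertices. -/
theorem IsMinor.of_suppress {x a b : V} (hxa : G.Adj x a) (hxb : G.Adj x b)
    (hG' : ∀ u w, G'.Adj u w → G.Adj u w ∧ u ≠ x ∧ w ≠ x ∨ u = a ∧ w = b ∨ u = b ∧ w = a)
    (hH : ∀ i, ∃ j, H.Adj i j) (h : IsMinor H G') : IsMinor H G := by
  obtain ⟨B, hne, hd, hc, hadj⟩ := h
  have hx : ∀ w, ¬ G'.Adj x w := by
    intro w hw
    obtain h | ⟨h, -⟩ | ⟨h, -⟩ := hG' _ _ hw
    · exact h.2.1 rfl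
    · exact hxa.ne h
    · exact hxb.ne h
  have hxB : ∀ i, x ∉ B i := by
    intro i hi
    obtain ⟨j, hij⟩ := hH i
    obtain ⟨u, hu, v, hv, huv⟩ := hadj hij
    obtain ⟨p⟩ := (hc i).preconnected ⟨x, hi⟩ ⟨u, hu⟩
    cases p with
    | nil => exact hx _ huv
    | cons h _ => exact hx _ h
  have hsub : ∀ i, B i ⊆ B i ∪ {y | y = x ∧ a ∈ B i} := fun i => Set.subset_union_left
  refine ⟨fun i => B i ∪ {y | y = x ∧ a ∈ B i}, fun i => (hne i).mono (hsub i), ?_, ?_, ?_⟩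
  · intro i j hij
    have hdij := Set.disjoint_left.1 (hd hij)
    refine Set.disjoint_left.2 ?_
    rintro y (hy | ⟨rfl, hy⟩) (hy' | ⟨hy1, hy'⟩)
    · exact hdij hy hy'
    · exact hxB i (hy1 ▸ hy)
    · exact hxB j hy'
    · exact hdij hy hy'
  · intro i
    refine (hc i).induce_of_adj_reachable (hsub i) ?_ ?_
    · have hab : ∀ (ha : a ∈ B i) (hb : b ∈ B i),
          (G.induce (B i ∪ {y | y = x ∧ a ∈ B i})).Reachable ⟨a, hsub i ha⟩ ⟨b, hsub i hb⟩ := by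
        intro ha hb
        have h1 : (G.induce (B i ∪ {y | y = x ∧ a ∈ B i})).Adj ⟨a, hsub i ha⟩
          ⟨x, Or.inr ⟨rfl, ha⟩⟩ := hxa.symm
        have h2 : (G.induce (B i ∪ {y | y = x ∧ a ∈ B i})).Adj ⟨x, Or.inr ⟨rfl, ha⟩⟩
          ⟨b, hsub i hb⟩ := hxb
        exact h1.reachable.trans h2.reachable
      rintro ⟨u, hu⟩ ⟨w, hw⟩ huw
      obtain h | ⟨h1, h2⟩ | ⟨h1, h2⟩ := hG' _ _ huw
      · exact Adj.reachable (show G.Adj u w from h.1)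
      · dsimp only at h1 h2
        subst h1 h2
        exact hab hu hw
      · dsimp only at h1 h2
        subst h1 h2
        exact (hab hw hu).symm
    · rintro ⟨t, ht | ⟨rfl, ht⟩⟩
      · exact ⟨⟨t, ht⟩, by rfl⟩
      · exact ⟨⟨a, ht⟩, Adj.reachable (show G.Adj t a from hxa)⟩
  · intro i j hij
    obtain ⟨u, hu, v, hv, huv⟩ := hadj hij
    obtain h | ⟨rfl, rfl⟩ | ⟨rfl, rfl⟩ := hG' _ _ huv
    · exact ⟨u, hsub i hu, v, hsub j hv, h.1⟩
    · exact ⟨x, Or.inr ⟨rfl, hu⟩, v, hsub j hv, hxb⟩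
    · exact ⟨u, hsub i hu, x, Or.inr ⟨rfl, hv⟩, hxb.symm⟩

end Minor

/-- The first `k + 1` values of `f` form a path in `G`. -/
def IsPathSeq {V : Type} (G : SimpleGraph V) (k : ℕ) (f : ℕ → V) : Prop :=
  (∀ t < k, G.Adj (f t) (f (t + 1))) ∧ Set.InjOn f (Set.Iic k)

section PathSeq

variable {V : Type} {G : SimpleGraph V} {k : ℕ} {f : ℕ → V}

theorem IsPathSeq.connected_induce_Icc (hf : IsPathSeq G k f) {l r : ℕ} (hlr : l ≤ r)
    (hr : r ≤ k) : (G.induce (f '' Set.Icc l r)).Connected := by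
  have key : ∀ t, l ≤ t → ∀ ht : t ≤ r, ∀ hl : l ≤ t, (G.induce (f '' Set.Icc l r)).Reachable
      ⟨f l, l, ⟨le_rfl, hlr⟩, rfl⟩ ⟨f t, t, ⟨hl, ht⟩, rfl⟩ := by
    intro t hlt
    induction t, hlt using Nat.le_induction with
    | base => intros; rfl
    | succ t hlt ih =>
      intro ht _
      exact (ih (by omega) hlt).trans
        (Adj.reachable (show G.Adj (f t) (f (t + 1)) from hf.1 t (by omega)))
  refine (connected_iff _).2 ⟨?_, ⟨⟨f l, l, ⟨le_rfl, hlr⟩, rfl⟩⟩⟩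
  rintro ⟨_, s, hs, rfl⟩ ⟨_, t, ht, rfl⟩
  exact (key s hs.1 hs.2 hs.1).symm.trans (key t ht.1 ht.2 ht.1)

theorem IsPathSeq.isMinor {W : Type} {H : SimpleGraph W} (hf : IsPathSeq G k f) (l r : W → ℕ)
    (hlr : ∀ i, l i ≤ r i ∧ r i ≤ k) (hd : ∀ i j, i ≠ j → r i < l j ∨ r j < l i)
    (hadj : ∀ i j, H.Adj i j → ∃ s t, (l i ≤ s ∧ s ≤ r i) ∧ (l j ≤ t ∧ t ≤ r j) ∧
      G.Adj (f s) (f t)) : IsMinor H G := by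
  refine ⟨fun i => f '' Set.Icc (l i) (r i), fun i => ⟨_, l i, ⟨le_rfl, (hlr i).1⟩, rfl⟩, ?_,
    fun i => hf.connected_induce_Icc (hlr i).1 (hlr i).2, ?_⟩
  · intro i j hij
    refine Set.disjoint_left.2 ?_
    rintro _ ⟨s, hs, rfl⟩ ⟨t, ht, hst⟩
    have h1 := (hlr i).2
    have h2 := (hlr j).2
    have := hf.2 (Set.mem_Iic.2 (ht.2.trans h2)) (Set.mem_Iic.2 (hs.2.trans h1)) hst
    have h3 := hd i j hij
    have h4 := hs.1
    have h5 := hs.2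
    have h6 := ht.1
    have h7 := ht.2
    omega
  · intro i j hij
    obtain ⟨s, t, hs, ht, hst⟩ := hadj i j hij
    exact ⟨f s, ⟨s, hs, rfl⟩, f t, ⟨t, ht, rfl⟩, hst⟩

/-- Five disjoint segments of a path, two of which are joined to each of the other three,
yield a `K_{2,3}` minor. -/
theorem IsPathSeq.isMinor_completeBipartiteGraph (hf : IsPathSeq G k f)
    (l r : Fin 2 → ℕ) (l' r' : Fin 3 → ℕ)
    (hlr : ∀ i, l i ≤ r i ∧ r i ≤ k) (hlr' : ∀ i, l' i ≤ r' i ∧ r' i ≤ k)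
    (hd : ∀ i j, i ≠ j → r i < l j ∨ r j < l i)
    (hd' : ∀ i j, i ≠ j → r' i < l' j ∨ r' j < l' i)
    (hdd : ∀ i j, r i < l' j ∨ r' j < l i)
    (hadj : ∀ i j, ∃ s t, (l i ≤ s ∧ s ≤ r i) ∧ (l' j ≤ t ∧ t ≤ r' j) ∧ G.Adj (f s) (f t)) :
    IsMinor (completeBipartiteGraph (Fin 2) (Fin 3)) G := by
  refine hf.isMinor (Sum.elim l l') (Sum.elim r r') ?_ ?_ ?_
  · rintro (i | i)
    · exact hlr i
    · exact hlr' i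
  · rintro (i | i) (j | j) hij
    · exact hd i j fun h => hij (congrArg _ h)
    · exact hdd i j
    · exact (hdd j i).symm
    · exact hd' i j fun h => hij (congrArg _ h)
  · rintro (i | i) (j | j) hij
    · simp at hij
    · exact hadj i j
    · obtain ⟨s, t, hs, ht, hst⟩ := hadj j i
      exact ⟨t, s, ht, hs, hst.symm⟩
    · simp at hij

theorem IsPathSeq.eq_of_crossing_chords (hf : IsPathSeq G k f)
    (hG : ¬ IsMinor (completeBipartiteGraph (Fin 2) (Fin 3)) G) {i m j : ℕ} (hi : 2 ≤ i)
    (him : i < m) (hmj : m ≤ j) (hjk : j ≤ k) (h0i : G.Adj (f 0) (f i))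
    (hm : G.Adj (f (i - 1)) (f m)) (h0j : G.Adj (f 0) (f j)) : i = 2 ∧ m = 3 ∧ j = 3 := by
  have hstep : ∀ s t, t = s + 1 → s < k → G.Adj (f s) (f t) := by
    rintro s _ rfl hs
    exact hf.1 s hs
  have h2 : i = 2 := by
    by_contra hne
    refine hG (hf.isMinor_completeBipartiteGraph ![0, i - 1] ![0, i - 1] ![1, i, m] ![i - 2, i, j]
      ?_ ?_ ?_ ?_ ?_ ?_)
    · simp [Fin.forall_fin_succ]; omega
    · simp [Fin.forall_fin_succ]; omega
    · simp [Fin.forall_fin_succ]; omega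
    · simp [Fin.forall_fin_succ]; omega
    · simp [Fin.forall_fin_succ]; omega
    · simp only [Fin.forall_fin_succ, IsEmpty.forall_iff, and_true]
      refine ⟨⟨⟨0, 1, ?_, ?_, hstep _ _ ?_ ?_⟩, ⟨0, i, ?_, ?_, h0i⟩, ⟨0, j, ?_, ?_, h0j⟩⟩,
        ⟨i - 1, i - 2, ?_, ?_, (hstep _ _ ?_ ?_).symm⟩, ⟨i - 1, i, ?_, ?_, hstep _ _ ?_ ?_⟩,
        ⟨i - 1, m, ?_, ?_, hm⟩⟩ <;> (try simp) <;> omega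
  have h3 : m = i + 1 := by
    by_contra hne
    refine hG (hf.isMinor_completeBipartiteGraph ![i, m] ![i, j] ![0, i - 1, i + 1]
      ![0, i - 1, m - 1] ?_ ?_ ?_ ?_ ?_ ?_)
    · simp [Fin.forall_fin_succ]; omega
    · simp [Fin.forall_fin_succ]; omega
    · simp [Fin.forall_fin_succ]; omega
    · simp [Fin.forall_fin_succ]; omega
    · simp [Fin.forall_fin_succ]; omega
    · simp only [Fin.forall_fin_succ, IsEmpty.forall_iff, and_true]
      refine ⟨⟨⟨i, 0, ?_, ?_, h0i.symm⟩, ⟨i, i - 1, ?_, ?_, (hstep _ _ ?_ ?_).symm⟩,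
        ⟨i, i + 1, ?_, ?_, hstep _ _ ?_ ?_⟩⟩, ⟨j, 0, ?_, ?_, h0j.symm⟩,
        ⟨m, i - 1, ?_, ?_, hm.symm⟩, ⟨m, m - 1, ?_, ?_, (hstep _ _ ?_ ?_).symm⟩⟩ <;>
        (try simp) <;> omega
  have h4 : j = m := by
    by_contra hne
    refine hG (hf.isMinor_completeBipartiteGraph ![0, m] ![0, m] ![1, i, m + 1]
      ![i - 1, m - 1, j] ?_ ?_ ?_ ?_ ?_ ?_)
    · simp [Fin.forall_fin_succ]; omega
    · simp [Fin.forall_fin_succ]; omega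
    · simp [Fin.forall_fin_succ]; omega
    · simp [Fin.forall_fin_succ]; omega
    · simp [Fin.forall_fin_succ]; omega
    · simp only [Fin.forall_fin_succ, IsEmpty.forall_iff, and_true]
      refine ⟨⟨⟨0, 1, ?_, ?_, hstep _ _ ?_ ?_⟩, ⟨0, i, ?_, ?_, h0i⟩, ⟨0, j, ?_, ?_, h0j⟩⟩,
        ⟨m, i - 1, ?_, ?_, hm.symm⟩, ⟨m, m - 1, ?_, ?_, (hstep _ _ ?_ ?_).symm⟩,
        ⟨m, m + 1, ?_, ?_, hstep _ _ ?_ ?_⟩⟩ <;> (try simp) <;> omega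
  omega


theorem IsPathSeq.exists_eq_of_adj (hf : IsPathSeq G k f) (hmax : ∀ g, ¬ IsPathSeq G (k + 1) g)
    {w : V} (hw : G.Adj (f 0) w) : ∃ t, 1 ≤ t ∧ t ≤ k ∧ f t = w := by
  by_contra! hne
  have hne' : ∀ t ≤ k, f t ≠ w := by
    intro t ht
    obtain rfl | h := Nat.eq_zero_or_pos t
    · exact hw.ne
    · exact hne t h ht
  refine hmax (fun t => if t = 0 then w else f (t - 1)) ⟨?_, ?_⟩
  · rintro (_ | t) ht
    · simpa using hw.symm
    · simpa using hf.1 t (by omega)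
  · rintro (_ | s) hs (_ | t) ht hst
    · rfl
    · exact absurd (by simpa using hst.symm) (hne' t (by simpa using ht))
    · exact absurd (by simpa using hst) (hne' s (by simpa using hs))
    · have := hf.2 (show s ∈ Set.Iic k by simpa using hs) (show t ∈ Set.Iic k by simpa using ht)
        (by simpa using hst)
      rw [this]

/-- Reverse the first `i` values of the sequence `f`. -/
def reverseInit {V : Type} (i : ℕ) (f : ℕ → V) (t : ℕ) : V :=
  if t < i then f (i - 1 - t) else f t

theorem reverseInit_of_lt {i t : ℕ} (h : t < i) : reverseInit i f t = f (i - 1 - t) := if_pos h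

theorem reverseInit_of_le {i t : ℕ} (h : i ≤ t) : reverseInit i f t = f t := if_neg (by omega)

theorem IsPathSeq.isPathSeq_reverseInit (hf : IsPathSeq G k f) {i : ℕ} (hik : i ≤ k)
    (h0i : G.Adj (f 0) (f i)) : IsPathSeq G k (reverseInit i f) := by
  refine ⟨fun t ht => ?_, fun s hs t ht hst => ?_⟩
  · rcases lt_trichotomy (t + 1) i with h | h | h
    · rw [reverseInit_of_lt h, reverseInit_of_lt (by omega)]
      have := hf.1 (i - 1 - (t + 1)) (by omega)
      rw [show i - 1 - (t + 1) + 1 = i - 1 - t by omega] at this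
      exact this.symm
    · rw [reverseInit_of_lt (by omega), reverseInit_of_le h.ge, h,
        show i - 1 - t = 0 by omega]
      exact h0i
    · rw [reverseInit_of_le (by omega), reverseInit_of_le (by omega)]
      exact hf.1 t ht
  · have hinj : ∀ a b, a ≤ k → b ≤ k → f a = f b → a = b := fun a b ha hb h => hf.2 ha hb h
    simp only [Set.mem_Iic] at hs ht
    rcases lt_or_ge s i with h | h <;> rcases lt_or_ge t i with h' | h'
    · rw [reverseInit_of_lt h, reverseInit_of_lt h'] at hst
      have := hinj _ _ (by omega) (by omega) hst
      omega
    · rw [reverseInit_of_lt h, reverseInit_of_le h'] at hst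
      have := hinj _ _ (by omega) (by omega) hst
      omega
    · rw [reverseInit_of_le h, reverseInit_of_lt h'] at hst
      have := hinj _ _ (by omega) (by omega) hst
      omega
    · rw [reverseInit_of_le h, reverseInit_of_le h'] at hst
      exact hinj _ _ hs ht hst

/-- If `i ≥ 2` is smallest such that a longest path has a chord from its first vertex to the
vertex in position `i`, then `i = 2` and any longer chord from the first vertex has length `3`. -/
theorem IsPathSeq.eq_of_minimal_chord (hf : IsPathSeq G k f)
    (hmax : ∀ g, ¬ IsPathSeq G (k + 1) g)
    (hG : ¬ IsMinor (completeBipartiteGraph (Fin 2) (Fin 3)) G)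
    (hdeg : ∀ x, (∃ y, G.Adj x y) → ∀ a b, ∃ c, G.Adj x c ∧ c ≠ a ∧ c ≠ b) {i j : ℕ}
    (hmin : ∀ g, IsPathSeq G k g → ∀ t, 2 ≤ t → t ≤ k → G.Adj (g 0) (g t) → i ≤ t)
    (hi : 2 ≤ i) (hij : i < j) (hjk : j ≤ k) (h0i : G.Adj (f 0) (f i))
    (h0j : G.Adj (f 0) (f j)) : i = 2 ∧ j = 3 := by
  have hg := hf.isPathSeq_reverseInit (by omega) h0i
  have hg0 : reverseInit i f 0 = f (i - 1) := reverseInit_of_lt (by omega)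
  have hg1 : reverseInit i f (i - 1) = f 0 := by
    rw [reverseInit_of_lt (by omega), Nat.sub_self]
  have hgi : reverseInit i f i = f i := reverseInit_of_le le_rfl
  obtain ⟨c, hc, hc1, hci⟩ := hdeg (reverseInit i f 0) ⟨_, hg.1 0 (by omega)⟩
    (reverseInit i f 1) (reverseInit i f i)
  obtain ⟨m, hm1, hmk, rfl⟩ := hg.exists_eq_of_adj hmax hc
  have hm1' : m ≠ 1 := by rintro rfl; exact hc1 rfl
  have hmi : m ≠ i := by rintro rfl; exact hci rfl
  have him := hmin _ hg m (by omega) hmk hc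
  have hgi' : G.Adj (reverseInit i f 0) (reverseInit i f i) := by
    rw [hg0, hgi]
    have := hf.1 (i - 1) (by omega)
    rwa [Nat.sub_add_cancel (by omega)] at this
  rcases le_total m j with hmj | hjm
  · have := hf.eq_of_crossing_chords hG hi (show i < m by omega) hmj hjk h0i
      (by rwa [hg0, reverseInit_of_le him] at hc) h0j
    omega
  · have := hg.eq_of_crossing_chords hG hi hij hjm hmk hgi'
      (by rwa [hg1, reverseInit_of_le hij.le]) hc
    omega

theorem IsPathSeq.adj_of_chord_two (hf : IsPathSeq G k f)
    (hmax : ∀ g, ¬ IsPathSeq G (k + 1) g)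
    (hG : ¬ IsMinor (completeBipartiteGraph (Fin 2) (Fin 3)) G)
    (hdeg : ∀ x, (∃ y, G.Adj x y) → ∀ a b, ∃ c, G.Adj x c ∧ c ≠ a ∧ c ≠ b)
    (h02 : G.Adj (f 0) (f 2)) :
    3 ≤ k ∧ G.Adj (f 0) (f 3) ∧ ∀ w, G.Adj (f 0) w → w = f 1 ∨ w = f 2 ∨ w = f 3 := by
  have key : ∀ t, 1 ≤ t → t ≤ k → G.Adj (f 0) (f t) → t = 1 ∨ t = 2 ∨ t = 3 := by
    intro t h1 htk h
    by_cases h3 : 2 < t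
    · have := hf.eq_of_minimal_chord hmax hG hdeg (fun _ _ _ h _ _ => h) le_rfl h3 htk h02 h
      omega
    · omega
  refine ⟨?_, ?_, ?_⟩
  rotate_left 2
  · intro w hw
    obtain ⟨t, ht, htk, rfl⟩ := hf.exists_eq_of_adj hmax hw
    obtain rfl | rfl | rfl := key t ht htk hw <;> simp
  all_goals
    obtain ⟨c, hc, hc1, hc2⟩ := hdeg (f 0) ⟨_, h02⟩ (f 1) (f 2)
    obtain ⟨t, ht, htk, rfl⟩ := hf.exists_eq_of_adj hmax hc
    obtain rfl | rfl | rfl := key t ht htk hc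
    · exact absurd rfl hc1
    · exact absurd rfl hc2
    · first | exact htk | exact hc

end PathSeq

theorem exists_isPathSeq_maximal {V : Type} [Fintype V] (G : SimpleGraph V) (v : V) :
    ∃ k f, IsPathSeq G k f ∧ ∀ g, ¬ IsPathSeq G (k + 1) g := by
  by_contra! h
  have key : ∀ k, ∃ f, IsPathSeq G k f := by
    intro k
    induction k with
    | zero =>
      refine ⟨fun _ => v, fun t ht => absurd ht (Nat.not_lt_zero t), fun s hs t ht _ => ?_⟩
      simp only [Set.mem_Iic] at hs ht
      omega
    | succ k ih =>
      obtain ⟨f, hf⟩ := ih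
      exact h k f hf
  obtain ⟨f, hf⟩ := key (Fintype.card V)
  have : Function.Injective fun i : Fin (Fintype.card V + 1) => f i := fun i j hij =>
    Fin.ext (hf.2 (Nat.le_of_lt_succ i.2) (Nat.le_of_lt_succ j.2) hij)
  have := Fintype.card_le_of_injective _ this
  simp at this

/-- A graph with an edge, no `K_{2,3}` minor and no vertex of degree one or two has a
clique of four vertices, three of which have no further neighbours. -/
theorem exists_pendant_four_clique {V : Type} [Fintype V] {G : SimpleGraph V}
    (hG : ¬ IsMinor (completeBipartiteGraph (Fin 2) (Fin 3)) G)
    (hdeg : ∀ x, (∃ y, G.Adj x y) → ∀ a b, ∃ c, G.Adj x c ∧ c ≠ a ∧ c ≠ b)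
    {u v : V} (huv : G.Adj u v) :
    ∃ x y z w, G.Adj x y ∧ (∀ s, G.Adj x s → s = y ∨ s = z ∨ s = w) ∧
      (∀ s, G.Adj y s → s = x ∨ s = z ∨ s = w) ∧ ∀ s, G.Adj z s → s = x ∨ s = y ∨ s = w := by
  classical
  obtain ⟨k, f, hf, hmax⟩ := exists_isPathSeq_maximal G u
  have hk : 1 ≤ k := by
    by_contra hk
    obtain rfl : k = 0 := by omega
    refine hmax (fun t => if t = 0 then u else v) ⟨fun t ht => ?_, fun s hs t ht hst => ?_⟩
    · obtain rfl : t = 0 := by omega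
      simpa using huv
    · simp only [Set.mem_Iic] at hs ht
      have := huv.ne
      interval_cases s <;> interval_cases t <;> simp_all
  have hlong : ∀ g, IsPathSeq G k g → ∀ i, ∃ t, t ≠ i ∧ 2 ≤ t ∧ t ≤ k ∧ G.Adj (g 0) (g t) := by
    intro g hg i
    obtain ⟨c, hc, hc1, hc2⟩ := hdeg (g 0) ⟨_, hg.1 0 (by omega)⟩ (g 1) (g i)
    obtain ⟨t, ht, htk, rfl⟩ := hg.exists_eq_of_adj hmax hc
    refine ⟨t, ?_, ?_, htk, hc⟩
    · rintro rfl; exact hc2 rfl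
    · have : t ≠ 1 := by rintro rfl; exact hc1 rfl
      omega
  have hex : ∃ i, ∃ g, IsPathSeq G k g ∧ 2 ≤ i ∧ i ≤ k ∧ G.Adj (g 0) (g i) := by
    obtain ⟨t, -, h⟩ := hlong f hf 0
    exact ⟨t, f, hf, h⟩
  obtain ⟨g, hg, hi, hik, h0i⟩ := Nat.find_spec hex
  have hmin : ∀ g, IsPathSeq G k g → ∀ t, 2 ≤ t → t ≤ k → G.Adj (g 0) (g t) →
      Nat.find hex ≤ t := fun g hg t h2 htk h => Nat.find_min' hex ⟨g, hg, h2, htk, h⟩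
  obtain ⟨j, hji, hj2, hjk, h0j⟩ := hlong g hg (Nat.find hex)
  have hij := hmin g hg j hj2 hjk h0j
  obtain ⟨hi2, -⟩ := hg.eq_of_minimal_chord hmax hG hdeg hmin hi (by omega) hjk h0i h0j
  rw [hi2] at h0i hik
  obtain ⟨hk3, h03, h0⟩ := hg.adj_of_chord_two hmax hG hdeg h0i
  have h1 := (hg.isPathSeq_reverseInit hik h0i).adj_of_chord_two hmax hG hdeg
    (by simpa [reverseInit] using hg.1 1 (by omega))
  have h2 := (hg.isPathSeq_reverseInit hk3 h03).adj_of_chord_two hmax hG hdeg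
    (by simpa [reverseInit] using h0i.symm)
  simp only [reverseInit] at h1 h2
  norm_num at h1 h2
  exact ⟨g 0, g 1, g 2, g 3, hg.1 0 (by omega), h0, h1.2.2,
    fun s hs => by have := h2.2.2 s hs; tauto⟩

/-- `I` is independent and deleting it leaves a graph in which every edge is on at most one
cycle. -/
def IsCactusDeletion {V : Type} (G : SimpleGraph V) (I : Set V) : Prop :=
  (∀ x ∈ I, ∀ y ∈ I, ¬ G.Adj x y) ∧ EdgeOnAtMostOneCycle (isolate G I)

section Reduction

variable {V : Type} {G G' : SimpleGraph V} {x : V} {I : Set V}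

theorem IsCactusDeletion.insert (hle : isolate G {x} ≤ G') (h : IsCactusDeletion G' I)
    (hx : ∀ y, G.Adj x y → y ∉ I) : IsCactusDeletion G (I ∪ {x}) := by
  refine ⟨?_, h.2.mono ?_⟩
  · rintro u (hu | rfl) v (hv | rfl) huv
    · by_cases hux : u = x
      · exact hx v (hux ▸ huv) hv
      · by_cases hvx : v = x
        · exact hx u (hvx ▸ huv.symm) hu
        · exact h.1 u hu v hv (hle ⟨huv, hux, hvx⟩)
    · exact hx u huv.symm hu
    · exact hx v huv hv
    · exact G.loopless.irrefl _ huv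
  · rintro u v ⟨huv, hu, hv⟩
    simp only [Set.mem_union, Set.mem_singleton_iff, not_or] at hu hv
    exact ⟨hle ⟨huv, hu.2, hv.2⟩, hu.1, hv.1⟩

theorem IsCactusDeletion.indep_diff (hle : isolate G {x} ≤ G') (h : IsCactusDeletion G' I) :
    ∀ u ∈ I \ {x}, ∀ v ∈ I \ {x}, ¬ G.Adj u v :=
  fun u hu v hv huv => h.1 u hu.1 v hv.1 (hle ⟨huv, hu.2, hv.2⟩)

theorem IsCactusDeletion.isolate_isolate_diff (hle : isolate G {x} ≤ G')
    (h : IsCactusDeletion G' I) :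
    EdgeOnAtMostOneCycle (isolate (isolate G (I \ {x})) {x}) := by
  refine h.2.mono ?_
  rintro u v ⟨⟨huv, hu, hv⟩, hu', hv'⟩
  exact ⟨hle ⟨huv, hu', hv'⟩, fun h => hu ⟨h, hu'⟩, fun h => hv ⟨h, hv'⟩⟩

theorem IsCactusDeletion.diff_of_leaf {a : V} (hle : isolate G {x} ≤ G')
    (h : IsCactusDeletion G' I) (hx : ∀ y, G.Adj x y → y ∉ I → y = a) :
    IsCactusDeletion G (I \ {x}) :=
  ⟨h.indep_diff hle, (h.isolate_isolate_diff hle).of_isolate_of_leaf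
    fun y hy => hx y hy.1 fun hyI => hy.2.2 ⟨hyI, hy.1.ne'⟩⟩

theorem IsCactusDeletion.diff_of_pendant_triangle {z w : V} (hle : isolate G {x} ≤ G')
    (h : IsCactusDeletion G' I) (hx : ∀ y, G.Adj x y → y ∉ I → y = z ∨ y = w)
    (hz : ∀ y, G.Adj z y → y ≠ x → y ∉ I → y = w) : IsCactusDeletion G (I \ {x}) := by
  refine ⟨h.indep_diff hle, (h.isolate_isolate_diff hle).of_isolate_of_pendant_triangle
    (fun y hy => hx y hy.1 fun hyI => hy.2.2 ⟨hyI, hy.1.ne'⟩) fun y hy => ?_⟩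
  by_cases hyx : y = x
  · exact Or.inl hyx
  · exact Or.inr (hz y hy.1 hyx fun hyI => hy.2.2 ⟨hyI, hyx⟩)

theorem ncard_edgeSet_isolate_lt [Finite V] {y : V} (hxy : G.Adj x y) :
    (isolate G {x}).edgeSet.ncard < G.edgeSet.ncard := by
  refine Set.ncard_lt_ncard ⟨edgeSet_mono (isolate_le G {x}), fun hsub => ?_⟩
  have : s(x, y) ∈ (isolate G {x}).edgeSet := hsub hxy
  exact this.2.1 rfl

theorem ncard_edgeSet_isolate_sup_edge_lt [Finite V] {a b : V} (hxa : G.Adj x a)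
    (hxb : G.Adj x b) (hab : a ≠ b) :
    (isolate G {x} ⊔ edge a b).edgeSet.ncard < G.edgeSet.ncard := by
  have h1 : (isolate G {x} ⊔ edge a b).edgeSet ⊆
      insert s(a, b) (G.edgeSet \ {s(x, a), s(x, b)}) := by
    intro e
    induction e with | _ u v
    rintro (⟨huv, hu, hv⟩ | huv)
    · refine Or.inr ⟨huv, ?_⟩
      simp only [Set.mem_singleton_iff] at hu hv
      simp [hu, hv]
    · left
      rw [edge_adj] at huv
      aesop
  have h2 : ({s(x, a), s(x, b)} : Set (Sym2 V)) ⊆ G.edgeSet := by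
    rintro e (rfl | rfl)
    exacts [hxa, hxb]
  have h3 : ({s(x, a), s(x, b)} : Set (Sym2 V)).ncard = 2 :=
    Set.ncard_pair fun h => hab (Sym2.congr_right.1 h)
  have h4 := Set.ncard_le_ncard h1
  have h5 := Set.ncard_insert_le s(a, b) (G.edgeSet \ {s(x, a), s(x, b)})
  have h6 := Set.ncard_sdiff_add_ncard_of_subset h2
  omega

end Reduction

theorem exists_isCactusDeletion {V : Type} [Fintype V] (n : ℕ) (G : SimpleGraph V)
    (hn : G.edgeSet.ncard = n) (hG : ¬ IsMinor (completeBipartiteGraph (Fin 2) (Fin 3)) G) :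
    ∃ I, IsCactusDeletion G I := by
  induction n using Nat.strong_induction_on generalizing G with
  | _ n ih =>
  subst hn
  by_cases hE : ∃ u v, G.Adj u v
  swap
  · push Not at hE
    refine ⟨∅, by simp, fun u v p q hp hq e hep => ?_⟩
    induction e with | _ a b
    exact absurd (p.adj_of_mem_edges hep).1 (hE a b)
  obtain ⟨u, v, huv⟩ := hE
  have hdel : ∀ x y, G.Adj x y → ∃ I, IsCactusDeletion (isolate G {x}) I := fun x y hxy =>
    ih _ (ncard_edgeSet_isolate_lt hxy) _ rfl fun h => hG (h.mono (isolate_le _ _))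
  by_cases hdeg : ∀ x, (∃ y, G.Adj x y) → ∀ a b, ∃ c, G.Adj x c ∧ c ≠ a ∧ c ≠ b
  · obtain ⟨x, y, z, w, hxy, hx, hy, hz⟩ := exists_pendant_four_clique hG hdeg huv
    obtain ⟨I, hI⟩ := hdel x y hxy
    by_cases hyI : y ∈ I
    · exact ⟨_, hI.diff_of_pendant_triangle le_rfl (z := z) (w := w)
        (fun s hs hsI => by grind) fun s hs hsx hsI => by grind⟩
    by_cases hzI : z ∈ I
    · exact ⟨_, hI.diff_of_pendant_triangle le_rfl (z := y) (w := w)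
        (fun s hs hsI => by grind) fun s hs hsx hsI => by grind⟩
    by_cases hwI : w ∈ I
    · exact ⟨_, hI.diff_of_pendant_triangle le_rfl (z := y) (w := z)
        (fun s hs hsI => by grind) fun s hs hsx hsI => by grind⟩
    · refine ⟨_, hI.insert le_rfl fun s hs => ?_⟩
      obtain rfl | rfl | rfl := hx s hs <;> assumption
  · push Not at hdeg
    obtain ⟨x, ⟨y, hxy⟩, a, b, hab⟩ := hdeg
    by_cases h : G.Adj x a ∧ G.Adj x b ∧ a ≠ b
    · obtain ⟨hxa, hxb, hne⟩ := h
      have hle : isolate G {x} ≤ isolate G {x} ⊔ edge a b := le_sup_left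
      have hadj : ∀ s t, (isolate G {x} ⊔ edge a b).Adj s t →
          G.Adj s t ∧ s ≠ x ∧ t ≠ x ∨ s = a ∧ t = b ∨ s = b ∧ t = a := by
        rintro s t (⟨hst, hs, ht⟩ | hst)
        · exact Or.inl ⟨hst, hs, ht⟩
        · exact Or.inr ((edge_adj ..).1 hst).1
      have hpos : ∀ i, ∃ j, (completeBipartiteGraph (Fin 2) (Fin 3)).Adj i j := by
        rintro (i | i)
        · exact ⟨Sum.inr 0, by simp⟩
        · exact ⟨Sum.inl 0, by simp⟩
      obtain ⟨I, hI⟩ := ih _ (ncard_edgeSet_isolate_sup_edge_lt hxa hxb hne) _ rfl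
        fun h => hG (h.of_suppress hxa hxb hadj hpos)
      by_cases haI : a ∈ I
      · exact ⟨_, hI.diff_of_leaf hle (a := b) fun s hs hsI =>
          hab s hs fun hsa => hsI (hsa ▸ haI)⟩
      by_cases hbI : b ∈ I
      · exact ⟨_, hI.diff_of_leaf hle (a := a) fun s hs hsI =>
          by_contra fun hsa => hsI (hab s hs hsa ▸ hbI)⟩
      · refine ⟨_, hI.insert hle fun s hs => ?_⟩
        by_cases hsa : s = a
        · exact hsa ▸ haI
        · exact hab s hs hsa ▸ hbI
    · obtain ⟨I, hI⟩ := hdel x y hxy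
      have : ∃ c, ∀ s, G.Adj x s → s = c := by
        by_cases hxa : G.Adj x a
        · refine ⟨a, fun s hs => by_contra fun hsa => ?_⟩
          obtain rfl := hab s hs hsa
          exact h ⟨hxa, hs, Ne.symm hsa⟩
        · refine ⟨b, fun s hs => hab s hs ?_⟩
          rintro rfl
          exact hxa hs
      obtain ⟨c, hc⟩ := this
      exact ⟨_, hI.diff_of_leaf le_rfl fun s hs _ => hc s hs⟩

theorem k23_minor_free_independent_set_cactus
    {V : Type} [Fintype V] (G : SimpleGraph V)
    (hG : ¬ IsMinor (completeBipartiteGraph (Fin 2) (Fin 3)) G) :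
    ∃ I : Set V, (∀ x ∈ I, ∀ y ∈ I, ¬ G.Adj x y) ∧
      EdgeOnAtMostOneCycle (G.induce Iᶜ) := by
  obtain ⟨I, hI, hI'⟩ := exists_isCactusDeletion _ G rfl hG
  exact ⟨I, hI, hI'.induce_compl⟩
end

section
/- Let ℓ ≥ 6 and q ≤ 3 be integers, let H be a finite simple graph on n ≥ 2 vertices having neither K_4 nor K_{2,3} as a minor (i.e., H is outerplanar), let v_n be a distinguished vertex of H, and let c_0, c_1, …, c_q be a prescribed sequence of colors for v_n with c_i ≠ c_{i+1} for each i. Then for every pair of proper ℓ-colorings α' and β' of H with α'(v_n) = c_0 and β'(v_n) = c_q, there exists a transformation from α' to β' recoloring each vertex at most 3 times in which v_n follows the prescribed coloring order c_0, c_1, …, c_q. -/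
open SimpleGraph

/-- The vertices of a nonempty path induce a connected subgraph. -/
theorem connected_induce_of_isChain {V : Type} (G : SimpleGraph V) {l : List V}
    (hne : l ≠ []) (hl : l.IsChain G.Adj) : (G.induce {x | x ∈ l}).Connected := by
  induction l with
  | nil => exact absurd rfl hne
  | cons a l ih =>
    cases l with
    | nil =>
      refine (SimpleGraph.connected_iff _).2 ⟨?_, ⟨a, by simp⟩⟩
      rintro ⟨x, hx⟩ ⟨y, hy⟩
      obtain rfl := List.mem_singleton.1 hx
      obtain rfl := List.mem_singleton.1 hy
      rfl
    | cons b l =>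
      rw [List.isChain_cons_cons] at hl
      have hunion : {x | x ∈ a :: b :: l} = ({a, b} : Set V) ∪ {x | x ∈ b :: l} := by
        ext; simp; tauto
      rw [hunion]
      exact SimpleGraph.induce_union_connected
        (SimpleGraph.induce_pair_connected_of_adj hl.1).preconnected
        (ih (by simp) hl.2).preconnected ⟨b, by simp⟩

/-- A path `u, …, y, b, …` in which `u` is adjacent to `b` and both `u` and `y` have neighbors
after `b` yields a `K₄` minor. -/
theorem isMinor_top_of_path {V : Type} (G : SimpleGraph V) {u y b a z : V} {M Q : List V}
    (hch : (u :: M ++ y :: b :: Q).IsChain G.Adj) (hnd : (u :: M ++ y :: b :: Q).Nodup)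
    (hub : G.Adj u b) (ha : a ∈ Q) (hua : G.Adj u a) (hz : z ∈ Q) (hyz : G.Adj y z) :
    IsMinor (⊤ : SimpleGraph (Fin 4)) G := by
  obtain ⟨h1, h2, h3⟩ := List.isChain_append.1 hch
  obtain ⟨hyb, hbQ⟩ := List.isChain_cons_cons.1 h2
  obtain ⟨c, Q', rfl⟩ := List.exists_cons_of_ne_nil (List.ne_nil_of_mem ha)
  obtain ⟨hbc, hQ⟩ := List.isChain_cons_cons.1 hbQ
  have hlast := h3 _ (List.getLast?_eq_getLast_of_ne_nil (List.cons_ne_nil u M)) y (by simp)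
  rw [List.nodup_append] at hnd
  obtain ⟨-, hn2, hn3⟩ := hnd
  rw [List.nodup_cons, List.nodup_cons] at hn2
  let B : Fin 4 → List V := ![u :: M, [y], [b], c :: Q']
  have hadj : ∀ i j : Fin 4, i < j → ∃ x ∈ B i, ∃ w ∈ B j, G.Adj x w := by
    intro i j hij
    fin_cases i <;> fin_cases j <;> first | (exfalso; revert hij; decide) | skip
    · exact ⟨_, List.getLast_mem (List.cons_ne_nil u M), y, by simp [B], hlast⟩
    · exact ⟨u, by simp [B], b, by simp [B], hub⟩
    · exact ⟨u, by simp [B], a, ha, hua⟩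
    · exact ⟨y, by simp [B], b, by simp [B], hyb⟩
    · exact ⟨y, by simp [B], z, hz, hyz⟩
    · exact ⟨b, by simp [B], c, by simp [B], hbc⟩
  have hdisj : ∀ i j : Fin 4, i < j → ∀ x ∈ B i, x ∉ B j := by
    intro i j hij x hx hx'
    fin_cases i <;> fin_cases j <;> simp [B] at hx hx' hij <;> grind
  refine ⟨fun i => {x | x ∈ B i}, ?_, ?_, ?_, ?_⟩
  · intro i
    fin_cases i
    exacts [⟨u, by simp [B]⟩, ⟨y, by simp [B]⟩, ⟨b, by simp [B]⟩, ⟨c, by simp [B]⟩]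
  · intro i j hij
    rw [Set.disjoint_left]
    intro x hx hx'
    rcases lt_or_gt_of_ne hij with h | h
    exacts [hdisj i j h x hx hx', hdisj j i h x hx' hx]
  · intro i
    apply connected_induce_of_isChain <;> fin_cases i
    all_goals first | exact List.cons_ne_nil _ _ | exact List.isChain_singleton _ | skip
    exacts [h1, hQ]
  · intro i j hij
    rcases lt_or_gt_of_ne hij.ne with h | h
    · exact hadj i j h
    · obtain ⟨x, hx, w, hw, hxw⟩ := hadj j i h
      exact ⟨w, hw, x, hx, hxw.symm⟩

/-- Two distinct members of a list satisfying `p` can be split off in order of appearance. -/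
theorem List.exists_append_cons_append_cons {α : Type} {p : α → Prop} {l : List α} {a b : α}
    (ha : a ∈ l) (hb : b ∈ l) (hab : a ≠ b) (hpa : p a) (hpb : p b) :
    ∃ X c Y d Z, l = X ++ c :: (Y ++ d :: Z) ∧ p c ∧ p d := by
  obtain ⟨X, Z, rfl⟩ := List.append_of_mem ha
  rcases List.mem_append.1 hb with h | h
  · obtain ⟨X, Y, rfl⟩ := List.append_of_mem h
    exact ⟨X, b, Y, a, Z, by simp, hpb, hpa⟩
  · obtain ⟨Y, Z, rfl⟩ := List.append_of_mem ((List.mem_cons.1 h).resolve_left hab.symm)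
    exact ⟨X, a, Y, b, Z, rfl, hpa, hpb⟩

/-- The rotation-extension argument: a path in `S` ending at `s`, all of whose inner vertices have
at least three neighbors in `S`, can be extended or rotated until a `K₄` minor appears. -/
theorem isMinor_top_of_path_of_three_le {V : Type} (G : SimpleGraph V) [DecidableRel G.Adj]
    [DecidableEq V] (S : Finset V) (s : V)
    (hdeg : ∀ x ∈ S, x ≠ s → (∃ y ∈ S, G.Adj x y) → 3 ≤ (S.filter (G.Adj x)).card) (n : ℕ) :
    ∀ (d : ℕ) (u : V) (A B : List V), (u :: (A ++ B)).IsChain G.Adj → (u :: (A ++ B)).Nodup →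
      (∀ x ∈ u :: (A ++ B), x ∈ S) → (A ++ B).getLast? = some s → (∀ x ∈ B, ¬ G.Adj u x) →
      S.card ≤ n + (u :: (A ++ B)).length → A.length ≤ d →
      IsMinor (⊤ : SimpleGraph (Fin 4)) G := by
  induction n using Nat.strong_induction_on with
  | _ n ihn =>
  intro d
  induction d with
  | zero =>
    intro u A B hch _ _ hs hB _ hA
    obtain rfl : A = [] := List.length_eq_zero_iff.1 (by omega)
    cases B with
    | nil => simp at hs
    | cons b B => exact absurd (List.isChain_cons_cons.1 hch).1 (hB b (by simp))
  | succ d ihd =>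
    intro u A B hch hnd hS hs hB hn hA
    have hus : u ≠ s := by
      rintro rfl
      exact (List.nodup_cons.1 hnd).1 (List.mem_of_getLast? hs)
    by_cases hout : ∃ w ∈ S, G.Adj u w ∧ w ∉ u :: (A ++ B)
    · obtain ⟨w, hwS, huw, hw⟩ := hout
      have hnd' : (w :: u :: (A ++ B)).Nodup := List.nodup_cons.2 ⟨hw, hnd⟩
      have hS' : ∀ x ∈ w :: u :: (A ++ B), x ∈ S := by
        intro x hx
        rcases List.mem_cons.1 hx with rfl | hx
        exacts [hwS, hS x hx]
      have hlen : (w :: u :: (A ++ B)).length ≤ S.card := by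
        rw [← List.toFinset_card_of_nodup hnd']
        exact Finset.card_le_card fun x hx => hS' x (List.mem_toFinset.1 hx)
      simp only [List.length_cons, List.length_append] at hn hlen
      refine ihn (n - 1) (by omega) (u :: (A ++ B)).length w (u :: (A ++ B)) [] ?_ ?_ ?_ ?_ ?_ ?_ ?_
      · simpa using ⟨huw.symm, hch⟩
      · simpa using hnd'
      · simpa using hS'
      · rw [List.append_nil, List.getLast?_cons, hs]; rfl
      · simp
      · simp only [List.length_cons, List.length_append, List.length_nil]; omega
      · exact le_rfl
    · push Not at hout
      have hmem : ∀ w ∈ S, G.Adj u w → w ∈ A := by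
        intro w hw huw
        have := hout w hw huw
        simp only [List.mem_cons, List.mem_append] at this
        rcases this with h | h | h
        exacts [absurd h huw.ne', h, absurd huw (hB w h)]
      cases A with
      | nil =>
        cases B with
        | nil => simp at hs
        | cons b B => exact absurd (List.isChain_cons_cons.1 hch).1 (hB b (by simp))
      | cons p A =>
      have hup : G.Adj u p := (List.isChain_cons_cons.1 hch).1
      have h3 := hdeg u (hS u (by simp)) hus ⟨p, hS p (by simp), hup⟩
      have h2 : 1 < ((S.filter (G.Adj u)).erase p).card := by
        have := Finset.pred_card_le_card_erase (a := p) (s := S.filter (G.Adj u))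
        omega
      obtain ⟨a, ha, b, hb, hab⟩ := Finset.one_lt_card.1 h2
      simp only [Finset.mem_erase, Finset.mem_filter] at ha hb
      obtain ⟨X, b, N, a, R, hX, hub, hua⟩ := List.exists_append_cons_append_cons (p := G.Adj u)
        ((List.mem_cons.1 (hmem a ha.2.1 ha.2.2)).resolve_left ha.1)
        ((List.mem_cons.1 (hmem b hb.2.1 hb.2.2)).resolve_left hb.1) hab ha.2.2 hb.2.2
      obtain ⟨M, y, hM⟩ := List.eq_nil_or_concat' (p :: X) |>.resolve_left (by simp)
      subst hX
      set Q := N ++ a :: (R ++ B) with hQ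
      have hL : u :: (p :: (X ++ b :: (N ++ a :: R)) ++ B) = u :: M ++ y :: b :: Q := by
        have : p :: (X ++ b :: (N ++ a :: R)) ++ B = (p :: X) ++ b :: Q := by simp [hQ]
        rw [this, hM]; simp
      rw [hL] at hch hnd hS
      by_cases hy : ∃ z ∈ Q, G.Adj y z
      · obtain ⟨z, hz, hyz⟩ := hy
        exact isMinor_top_of_path G hch hnd hub (by simp [hQ]) hua hz hyz
      · push Not at hy
        have hperm : (y :: ((M.reverse ++ [u, b]) ++ Q)).Perm (u :: M ++ y :: b :: Q) := by
          have : (M.reverse ++ (u :: b :: Q)).Perm (M ++ (u :: b :: Q)) :=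
            (List.reverse_perm M).append_right _
          simp only [List.append_assoc, List.cons_append, List.nil_append]
          grind
        have hMlen := congrArg List.length hM
        have hLlen := congrArg List.length hL
        refine ihd y (M.reverse ++ [u, b]) Q ?_ (hperm.nodup_iff.2 hnd)
          (fun x hx => hS x (hperm.mem_iff.1 hx)) ?_ hy ?_ ?_
        · have hsplit : u :: M ++ y :: b :: Q = (u :: M ++ [y]) ++ b :: Q := by simp
          obtain ⟨h1, h2, -⟩ := List.isChain_append.1 (hsplit ▸ hch)
          have h1' : (u :: M ++ [y]).reverse.IsChain G.Adj :=
            List.isChain_reverse.2 (h1.imp fun _ _ h => h.symm)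
          have := List.isChain_append.2 ⟨h1', h2, fun x hx w hw => ?_⟩
          · simpa using this
          · obtain rfl : u = x := by simpa [List.getLast?_cons] using hx
            obtain rfl : b = w := by simpa using hw
            exact hub
        · have hsuf : (p :: (X ++ b :: (N ++ a :: R)) ++ B) = (p :: X ++ [b]) ++ Q := by simp [hQ]
          have hQs : Q.getLast? = some (Q.getLast (by simp [hQ])) :=
            List.getLast?_eq_getLast_of_ne_nil _
          rw [hsuf, List.getLast?_append, hQs] at hs
          rw [List.getLast?_append, hQs]
          exact hs
        · rw [hperm.length_eq, ← hLlen]; exact hn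
        · simp at hA hMlen ⊢; omega

/-- In a `K₄`-minor-free graph, every vertex set having a vertex other than `s` has such a vertex
with at most two neighbors in the set. -/
theorem exists_card_filter_adj_le_two {V : Type} (G : SimpleGraph V) [DecidableRel G.Adj]
    [DecidableEq V] (h4 : ¬ IsMinor (⊤ : SimpleGraph (Fin 4)) G) (S : Finset V) (s : V)
    (hS : ∃ x ∈ S, x ≠ s) : ∃ x ∈ S, x ≠ s ∧ (S.filter (G.Adj x)).card ≤ 2 := by
  by_contra! h
  obtain ⟨x, hx, hxs⟩ := hS
  have key : ∀ t ∈ S, (∃ y ∈ S, G.Adj t y) →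
      (∀ x ∈ S, x ≠ t → (∃ y ∈ S, G.Adj x y) → 3 ≤ (S.filter (G.Adj x)).card) → False := by
    rintro t ht ⟨y, hy, hty⟩ hdeg
    refine h4 (isMinor_top_of_path_of_three_le G S t hdeg S.card 1 y [t] [] ?_ ?_ ?_ rfl ?_ ?_ ?_)
    · simpa using hty.symm
    · simpa using hty.ne'
    · simp [hy, ht]
    · simp
    · simp
    · simp
  have hex : ∃ y ∈ S, G.Adj x y := by
    obtain ⟨y, hy⟩ := Finset.card_pos.1 (lt_of_le_of_lt (Nat.zero_le 2) (h x hx hxs))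
    exact ⟨y, (Finset.mem_filter.1 hy).1, (Finset.mem_filter.1 hy).2⟩
  by_cases hs : s ∈ S ∧ ∃ y ∈ S, G.Adj s y
  · exact key s hs.1 hs.2 fun z hz hzs _ => h z hz hzs
  · refine key x hx hex fun z hz hzx hzy => h z hz ?_
    rintro rfl
    exact hs ⟨hz, hzy⟩

/-- `c` is proper on the subgraph of `G` induced by `S`. -/
def IsProperOn {V : Type} (G : SimpleGraph V) {ℓ : ℕ} (S : Finset V) (c : V → Fin ℓ) : Prop :=
  ∀ u ∈ S, ∀ v ∈ S, G.Adj u v → c u ≠ c v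

theorem IsProperOn.congr {V : Type} {G : SimpleGraph V} {ℓ : ℕ} {S : Finset V}
    {c c' : V → Fin ℓ} (h : IsProperOn G S c) (hc : ∀ x ∈ S, c x = c' x) :
    IsProperOn G S c' := fun u hu v hv huv => by
  rw [← hc u hu, ← hc v hv]
  exact h u hu v hv huv

/-- The list of moves `ms` (each a vertex of `S` with a new color for it) transforms the coloring
`c` into a coloring agreeing with `β` on `S`, through colorings that are proper on `S`. -/
def Recolors {V : Type} [DecidableEq V] (G : SimpleGraph V) {ℓ : ℕ} (S : Finset V)
    (β : V → Fin ℓ) : List (V × Fin ℓ) → (V → Fin ℓ) → Prop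
  | [], c => IsProperOn G S c ∧ ∀ x ∈ S, c x = β x
  | (v, a) :: ms, c =>
    IsProperOn G S c ∧ v ∈ S ∧ c v ≠ a ∧ Recolors G S β ms (Function.update c v a)

section Recolors

variable {V : Type} [DecidableEq V] {G : SimpleGraph V} {ℓ : ℕ} {S : Finset V} {β : V → Fin ℓ}

theorem Recolors.isProperOn {ms : List (V × Fin ℓ)} {c : V → Fin ℓ} (h : Recolors G S β ms c) :
    IsProperOn G S c := by
  cases ms with
  | nil => exact h.1
  | cons m ms => exact h.1

theorem Recolors.congr {ms : List (V × Fin ℓ)} {c c' : V → Fin ℓ} (h : Recolors G S β ms c)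
    (hc : ∀ x ∈ S, c x = c' x) : Recolors G S β ms c' := by
  induction ms generalizing c c' with
  | nil => exact ⟨h.1.congr hc, fun x hx => (hc x hx).symm.trans (h.2 x hx)⟩
  | cons m ms ih =>
    obtain ⟨hp, hv, hne, hr⟩ := h
    refine ⟨hp.congr hc, hv, by rwa [← hc _ hv], ih hr fun x hx => ?_⟩
    by_cases hxm : x = m.1 <;> simp [hxm, hc x hx]

theorem isProperOn_insert {w : V} {N : Finset V} (hN : ∀ x ∈ S, G.Adj w x → x ∈ N)
    {c : V → Fin ℓ} (h : IsProperOn G S c) (hw : ∀ x ∈ N, c w ≠ c x) :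
    IsProperOn G (insert w S) c := by
  intro u hu v hv huv
  rcases Finset.mem_insert.1 hu with hu | hu <;> rcases Finset.mem_insert.1 hv with hv | hv
  · exact absurd (hu.trans hv.symm) huv.ne
  · rw [hu] at huv ⊢; exact hw v (hN v hv huv)
  · rw [hv] at huv ⊢; exact (hw u (hN u hu huv.symm)).symm
  · exact h u hu v hv huv

/-- Colors given to vertices of `N` by the moves `ms`, in order. -/
def moveColors {ℓ : ℕ} (N : Finset V) (ms : List (V × Fin ℓ)) : List (Fin ℓ) :=
  (ms.filter (·.1 ∈ N)).map Prod.snd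

/-- Reinserting a vertex `w` with at most two neighbors: when a neighbor is about to take the color
of `w`, recolor `w` so as to avoid the current colors of its neighbors and their next three new
colors. Here the next `r` of these new colors are already known to differ from the color of `w`. -/
theorem Recolors.exists_insert (hℓ : 6 ≤ ℓ) {w : V} (hwS : w ∉ S) {N : Finset V}
    (hN : ∀ x ∈ S, G.Adj w x → x ∈ N) (hNS : N ⊆ S) (hNw : ∀ x ∈ N, G.Adj w x)
    (hcard : N.card ≤ 2) (hβ : IsProperOn G (insert w S) β) (ms : List (V × Fin ℓ)) :
    ∀ (n r : ℕ) (c : V → Fin ℓ), Recolors G S β ms c → IsProperOn G (insert w S) c →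
      c w ∉ (moveColors N ms).take r → (moveColors N ms).length ≤ r + 3 * n →
      ∃ ms', Recolors G (insert w S) β ms' c ∧ (ms'.filter (·.1 = w)).length ≤ n + 1 ∧
        ∀ v ≠ w, ms'.filter (·.1 = v) = ms.filter (·.1 = v) := by
  induction ms with
  | nil =>
    intro n r c hc hp _ _
    by_cases hcw : c w = β w
    · refine ⟨[], ⟨hp, fun x hx => ?_⟩, by simp, by simp⟩
      rcases Finset.mem_insert.1 hx with rfl | hx
      exacts [hcw, hc.2 x hx]
    · have hup : ∀ x ∈ insert w S, Function.update c w (β w) x = β x := by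
        intro x hx
        by_cases hxw : x = w
        · simp [hxw]
        · rw [Function.update_of_ne hxw, hc.2 x ((Finset.mem_insert.1 hx).resolve_left hxw)]
      refine ⟨[(w, β w)], ⟨hp, by simp, hcw, ?_, hup⟩, by simp, fun v hv => by simp [hv.symm]⟩
      exact hβ.congr fun x hx => (hup x hx).symm
  | cons m ms ih =>
    obtain ⟨v, a⟩ := m
    intro n r c hc hp hr hlen
    have hvS : v ∈ S := hc.2.1
    have hvw : v ≠ w := fun h => hwS (h ▸ hvS)
    -- performing the move `(v, a)` right away
    have step : ∀ (n r : ℕ) (c : V → Fin ℓ), Recolors G S β ((v, a) :: ms) c →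
        IsProperOn G (insert w S) c → (v ∈ N → c w ≠ a) →
        c w ∉ (moveColors N ms).take r → (moveColors N ms).length ≤ r + 3 * n →
        ∃ ms', Recolors G (insert w S) β ms' c ∧ (ms'.filter (·.1 = w)).length ≤ n + 1 ∧
          ∀ x ≠ w, ms'.filter (·.1 = x) = ((v, a) :: ms).filter (·.1 = x) := by
      intro n r c hc hp hva hr hlen
      have hw' : Function.update c v a w = c w := Function.update_of_ne hvw.symm _ _
      have hp' : IsProperOn G (insert w S) (Function.update c v a) := by
        refine isProperOn_insert hN hc.2.2.2.isProperOn fun x hx => ?_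
        rw [hw']
        by_cases hxv : x = v
        · subst hxv; simpa using hva hx
        · rw [Function.update_of_ne hxv]
          exact hp w (by simp) x (by simp [hNS hx]) (hNw x hx)
      obtain ⟨ms', h1, h2, h3⟩ := ih n r (Function.update c v a) hc.2.2.2 hp' (by rwa [hw']) hlen
      refine ⟨(v, a) :: ms', ⟨hp, by simp [hvS], hc.2.2.1, h1⟩, by simpa [hvw] using h2, ?_⟩
      intro x hx
      simp only [List.filter_cons, h3 x hx]
    by_cases hvN : v ∈ N
    · have hX : moveColors N ((v, a) :: ms) = a :: moveColors N ms := by simp [moveColors, hvN]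
      rw [hX] at hr hlen
      by_cases hca : c w = a
      · obtain rfl : r = 0 := by
          by_contra h
          obtain ⟨r, rfl⟩ := Nat.exists_eq_succ_of_ne_zero h
          simp [hca] at hr
        obtain ⟨n, rfl⟩ : ∃ k, n = k + 1 := ⟨n - 1, by simp at hlen; omega⟩
        obtain ⟨d, hd⟩ : ∃ d : Fin ℓ,
            d ∉ N.image c ∪ ((a :: moveColors N ms).take 3).toFinset := by
          by_contra! h
          have h1 := Finset.card_le_card (fun d _ => h d : Finset.univ ⊆ _)
          have h2 := Finset.card_union_le (N.image c) ((a :: moveColors N ms).take 3).toFinset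
          have h3 := Finset.card_image_le (s := N) (f := c)
          have h4 := List.toFinset_card_le ((a :: moveColors N ms).take 3)
          have h5 := List.length_take_le 3 (a :: moveColors N ms)
          rw [Finset.card_univ, Fintype.card_fin] at h1
          omega
        simp only [Finset.mem_union, Finset.mem_image, List.mem_toFinset, List.take_succ_cons,
          List.mem_cons, not_or, not_exists, not_and] at hd
        obtain ⟨hdN, hda, hd2⟩ := hd
        have hagree : ∀ x ∈ S, c x = Function.update c w d x := fun x hx =>
          (Function.update_of_ne (fun h : x = w => hwS (h ▸ hx)) _ _).symm
        have hp' : IsProperOn G (insert w S) (Function.update c w d) := by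
          refine isProperOn_insert hN (hc.isProperOn.congr hagree) fun x hx => ?_
          rw [← hagree x (hNS hx)]
          simpa using fun h => hdN x hx h.symm
        obtain ⟨ms', h1, h2, h3⟩ := step n 2 (Function.update c w d) (hc.congr hagree) hp'
          (by simpa using fun _ => hda) (by simpa using hd2) (by simp at hlen; omega)
        refine ⟨(w, d) :: ms', ⟨hp, by simp, by rw [hca]; exact Ne.symm hda, h1⟩,
          by simpa using h2, ?_⟩
        intro x hx
        rw [← h3 x hx]
        simp [hx.symm]
      · refine step n (r - 1) c hc hp (fun _ => hca) ?_ (by simp at hlen; omega)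
        cases r with
        | zero => simp
        | succ r => exact fun h => hr (List.mem_cons_of_mem _ h)
    · have hX : moveColors N ((v, a) :: ms) = moveColors N ms := by simp [moveColors, hvN]
      rw [hX] at hr hlen
      exact step n r c hc hp (fun h => absurd h hvN) hr hlen

theorem length_moveColors_le (N : Finset V) (ms : List (V × Fin ℓ)) (k : ℕ)
    (h : ∀ v ∈ N, (ms.filter (·.1 = v)).length ≤ k) :
    (moveColors N ms).length ≤ N.card * k := by
  have : (moveColors N ms).length = ∑ v ∈ N, (ms.filter (·.1 = v)).length := by
    induction ms with
    | nil => simp [moveColors]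
    | cons m ms ih =>
      have hcons : ∀ v, (((m :: ms).filter (·.1 = v)).length) =
          (if m.1 = v then 1 else 0) + (ms.filter (·.1 = v)).length := by
        intro v
        by_cases hm : m.1 = v <;> simp [hm, add_comm]
      simp only [hcons, Finset.sum_add_distrib, Finset.sum_ite_eq]
      rw [← ih fun v hv => le_trans (by rw [hcons]; omega) (h v hv)]
      by_cases hm : m.1 ∈ N <;> simp [moveColors, hm, add_comm]
  rw [this, ← smul_eq_mul]
  exact Finset.sum_le_card_nsmul N _ k h

theorem recolors_singleton (v : V) (l : List (Fin ℓ)) (c : V → Fin ℓ)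
    (hch : (c v :: l).IsChain (· ≠ ·)) (hlast : (c v :: l).getLast? = some (β v)) :
    Recolors G {v} β (l.map (v, ·)) c := by
  have hp : ∀ c : V → Fin ℓ, IsProperOn G {v} c := by
    intro c x hx y hy hxy
    rw [Finset.mem_singleton] at hx hy
    exact absurd (hx.trans hy.symm) hxy.ne
  induction l generalizing c with
  | nil => exact ⟨hp c, by simpa using hlast⟩
  | cons a l ih =>
    rw [List.isChain_cons_cons] at hch
    refine ⟨hp c, by simp, hch.1, ih _ ?_ ?_⟩
    · simpa using hch.2
    · simpa using hlast

/-- A list of moves valid on the whole graph unfolds to a transformation sequence. -/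
theorem Recolors.exists_isTransformSeq [Fintype V] {ms : List (V × Fin ℓ)} {c : V → Fin ℓ}
    (h : Recolors G Finset.univ β ms c) :
    ∃ (m : ℕ) (f : Fin (m + 1) → V → Fin ℓ), IsTransformSeq G f c β ∧
      (∀ v, RecolorCount f v = (ms.filter (·.1 = v)).length) ∧
      ∀ v, ColorTrace f v = c v :: (ms.filter (·.1 = v)).map Prod.snd := by
  induction ms generalizing c with
  | nil =>
    refine ⟨0, fun _ => c, ⟨rfl, funext fun x => h.2 x (by simp), ?_, fun i => i.elim0⟩, ?_, ?_⟩
    · exact fun _ u v huv => h.1 u (by simp) v (by simp) huv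
    · simp [RecolorCount]
    · simp [ColorTrace]
  | cons p ms ih =>
    obtain ⟨v, a⟩ := p
    obtain ⟨hp, -, hne, hr⟩ := h
    obtain ⟨m, f, ⟨h0, hl, hprop, huniq⟩, hcount, htrace⟩ := ih hr
    refine ⟨m + 1, Fin.cons c f, ⟨rfl, ?_, ?_, ?_⟩, ?_, ?_⟩
    · rw [← Fin.succ_last, Fin.cons_succ, hl]
    · intro i
      refine Fin.cases ?_ (fun i => ?_) i
      · exact fun u v huv => hp u (by simp) v (by simp) huv
      · exact hprop i
    · intro i
      refine Fin.cases ?_ (fun i => ?_) i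
      · refine ⟨v, by simpa [h0] using hne, fun y hy => ?_⟩
        by_contra hyv
        simp [h0, hyv] at hy
      · exact huniq i
    · intro x
      have h := hcount x
      rw [RecolorCount] at h
      rw [RecolorCount, Fin.card_filter_univ_succ]
      simp only [Fin.castSucc_zero, Fin.cons_zero, Fin.cons_succ, ← Fin.succ_castSucc, h,
        List.filter_cons, h0]
      by_cases hx : v = x
      · subst hx
        simp [hne]
      · simp [hx, Ne.symm hx]
    · intro x
      have h := htrace x
      rw [ColorTrace, List.ofFn_succ, h0, List.destutter_cons'] at h
      rw [ColorTrace, List.ofFn_succ, List.ofFn_succ]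
      simp only [Fin.cons_zero, Fin.cons_succ, h0, List.destutter_cons_cons, h]
      by_cases hx : v = x
      · subst hx
        simp [hne]
      · simpa [hx, Ne.symm hx] using h

end Recolors

theorem outerplanar_prescribed_order_recolor_six_colors
    {V : Type} [Fintype V] (H : SimpleGraph V) (hcard : 2 ≤ Fintype.card V)
    (h4 : ¬ IsMinor (⊤ : SimpleGraph (Fin 4)) H)
    (h23 : ¬ IsMinor (completeBipartiteGraph (Fin 2) (Fin 3)) H)
    (vn : V) (ℓ q : ℕ) (hℓ : 6 ≤ ℓ) (hq : q ≤ 3)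
    (cs : Fin (q + 1) → Fin ℓ) (hcs : ∀ i : Fin q, cs i.castSucc ≠ cs i.succ)
    (α β : V → Fin ℓ)
    (hα : IsProperColoring H α) (hβ : IsProperColoring H β)
    (hαv : α vn = cs 0) (hβv : β vn = cs (Fin.last q)) :
    ∃ (m : ℕ) (c : Fin (m + 1) → V → Fin ℓ),
      IsTransformSeq H c α β ∧
      (∀ v : V, RecolorCount c v ≤ 3) ∧
      ColorTrace c vn = List.ofFn cs := by
  classical
  have main : ∀ (k : ℕ) (S : Finset V), vn ∈ S → S.card = k + 1 →
      ∃ ms, Recolors H S β ms α ∧ (∀ v, (ms.filter (·.1 = v)).length ≤ 3) ∧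
        (ms.filter (·.1 = vn)).map Prod.snd = List.ofFn fun i : Fin q => cs i.succ := by
    intro k
    induction k with
    | zero =>
      intro S hS hk
      obtain ⟨x, rfl⟩ := Finset.card_eq_one.1 hk
      obtain rfl := Finset.mem_singleton.1 hS
      refine ⟨(List.ofFn fun i : Fin q => cs i.succ).map (vn, ·), ?_, ?_, ?_⟩
      · apply recolors_singleton
        · rw [hαv, ← List.ofFn_succ, List.isChain_ofFn]
          exact fun i hi => hcs ⟨i, by omega⟩
        · rw [hαv, ← List.ofFn_succ, hβv,
            List.getLast?_eq_getLast_of_ne_nil (by simp), List.getLast_ofFn_succ]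
      · intro v
        refine (List.length_filter_le _ _).trans ?_
        simpa using hq
      · rw [List.filter_eq_self.2 (by simp)]
        simp [Function.comp_def]
    | succ k ih =>
      intro S hS hk
      obtain ⟨w, hw, hwv, hdeg⟩ := exists_card_filter_adj_le_two H h4 S vn
        (Finset.exists_mem_ne (by omega) vn)
      obtain ⟨ms, h1, h2, h3⟩ := ih (S.erase w) (Finset.mem_erase.2 ⟨hwv.symm, hS⟩)
        (by rw [Finset.card_erase_of_mem hw, hk]; rfl)
      have hlen : (moveColors (S.filter (H.Adj w)) ms).length ≤ 0 + 3 * 2 :=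
        (length_moveColors_le _ ms 3 fun v _ => h2 v).trans (by omega)
      obtain ⟨ms', h1', h2', h3'⟩ := h1.exists_insert hℓ (Finset.notMem_erase w S)
        (N := S.filter (H.Adj w)) (fun x hx hwx => by simp [Finset.mem_of_mem_erase hx, hwx])
        (fun x hx => by
          obtain ⟨hx, hwx⟩ := Finset.mem_filter.1 hx
          exact Finset.mem_erase.2 ⟨hwx.ne', hx⟩)
        (fun x hx => (Finset.mem_filter.1 hx).2) hdeg (fun u _ v _ huv => hβ huv) ms 2 0 α
        (fun u _ v _ huv => hα huv) (by simp) hlen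
      rw [Finset.insert_erase hw] at h1'
      refine ⟨ms', h1', fun v => ?_, by rw [h3' vn hwv.symm, h3]⟩
      by_cases hv : v = w
      · exact hv ▸ h2'
      · rw [h3' v hv]
        exact h2 v
  obtain ⟨ms, h1, h2, h3⟩ := main (Fintype.card V - 1) Finset.univ (Finset.mem_univ vn)
    (by rw [Finset.card_univ]; omega)
  obtain ⟨m, c, hc, hcount, htrace⟩ := h1.exists_isTransformSeq
  refine ⟨m, c, hc, fun v => (hcount v).trans_le (h2 v), ?_⟩
  rw [htrace, h3, hαv, List.ofFn_succ]
end
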